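/- arXiv:2405.09615 — 4 statements merged into one kernel-verified Lean document; each statement's English description precedes it below -/
import Mathlib

section
/- Fix D ≥ 1, d ≥ 1, and let A : Matrix (Fin d) ((ZMod D) × (ZMod D)) ℂ be an MPS tensor with the Weyl–Heisenberg MF symmetry: for every (v, w) ∈ ZMod D × ZMod D there exist a unitary u ∈ Matrix (Fin d) (Fin d) ℂ, a pair (v', w') ∈ ZMod D × ZMod D and θ ∈ ℝ such that u * A = A * (conj(X^v * Z^w) ⊗ₖ (exp(iθ) • (X^{v'} * Z^{w'}))). Let Q ∈ Matrix ((ZMod D) × (ZMod D)) ((ZMod D) × (ZMod D)) ℂ be the positive semidefinite square root of Aᴴ * A, and define its sideways reshuffle V_Q : Matrix ((ZMod D) × (ZMod D) × (ZMod D)) (ZMod D) ℂ by V_Q (a', b', b) a := Q (a', b') (a, b). Then there exist a real number c ≥ 0, a Clifford unitary U_C on 3 qudits, and a vector ψ : (ZMod D) × (ZMod D) → ℂ with ‖ψ‖ = 1 (unit ℓ²-norm) such that for all x, y, z, a : ZMod D: V_Q (x, y, z) a = c * Σ_{x', y' : ZMod D} U_C (x, y, z) (x', y', a) * ψ (x',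 y'). In other words, V_Q is proportional to a Clifford unitary applied to the (possibly magic) fixed state ψ tensored with the identity on the virtual input. -/
open Matrix Kronecker ComplexOrder

/-- The qudit shift matrix `X`. -/
noncomputable def quditX (D : ℕ) : Matrix (ZMod D) (ZMod D) ℂ :=
  Matrix.of fun a b => if a = b + 1 then 1 else 0

/-- The qudit clock matrix `Z`, with `ω = exp (2πi/D)`. -/
noncomputable def quditZ (D : ℕ) : Matrix (ZMod D) (ZMod D) ℂ :=
  Matrix.of fun a b =>
    if a = b then Complex.exp (2 * Real.pi * Complex.I / D) ^ b.val else 0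

/-- The Weyl–Heisenberg operator `X^v * Z^w`. -/
noncomputable def quditXZ (D : ℕ) [NeZero D] (v w : ZMod D) :
    Matrix (ZMod D) (ZMod D) ℂ :=
  quditX D ^ v.val * quditZ D ^ w.val

/-- The 3-qudit Weyl–Heisenberg group, on the index type
`ZMod D × ZMod D × ZMod D`. -/
noncomputable def weylHeisenberg3 (D : ℕ) [NeZero D] :
    Set (Matrix (ZMod D × ZMod D × ZMod D) (ZMod D × ZMod D × ZMod D) ℂ) :=
  {M | ∃ (a₁ b₁ a₂ b₂ a₃ b₃ : ZMod D) (c : ℂ), ‖c‖ = 1 ∧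
    M = c • (quditXZ D a₁ b₁ ⊗ₖ (quditXZ D a₂ b₂ ⊗ₖ quditXZ D a₃ b₃))}

/-- A Clifford unitary on 3 qudits. -/
noncomputable def IsClifford3 (D : ℕ) [NeZero D]
    (U : Matrix (ZMod D × ZMod D × ZMod D) (ZMod D × ZMod D × ZMod D) ℂ) : Prop :=
  U ∈ Matrix.unitaryGroup (ZMod D × ZMod D × ZMod D) ℂ ∧
    ∀ w ∈ weylHeisenberg3 D, U * w * Uᴴ ∈ weylHeisenberg3 D

theorem quditX_pow_apply (D n : ℕ) [NeZero D] (a b : ZMod D) :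
    (quditX D ^ n) a b = if a = b + n then 1 else 0 := by
  induction n generalizing a b with
  | zero => simp [Matrix.one_apply]
  | succ n ih =>
    rw [pow_succ, Matrix.mul_apply, Finset.sum_eq_single (b + 1)]
    · rw [ih]
      simp [quditX, add_assoc, add_comm (1 : ZMod D)]
    · intro c _ hc
      simp [quditX, hc]
    · simp

theorem quditXZ_apply (D : ℕ) [NeZero D] (v w a b : ZMod D) :
    quditXZ D v w a b = if a = b + v then ZMod.stdAddChar (w * b) else 0 := by
  have hZ : quditZ D = Matrix.diagonal fun b : ZMod D =>
      Complex.exp (2 * Real.pi * Complex.I / D) ^ b.val := by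
    ext a b
    by_cases h : a = b <;> simp [quditZ, h]
  have hχ : (ZMod.stdAddChar (w * b) : ℂ) =
      (Complex.exp (2 * Real.pi * Complex.I / D) ^ b.val) ^ w.val := by
    have h := ZMod.stdAddChar_coe (N := D) ((w.val : ℤ) * b.val)
    push_cast at h
    rw [ZMod.natCast_zmod_val, ZMod.natCast_zmod_val] at h
    rw [h, ← pow_mul, ← Complex.exp_nat_mul]
    congr 1
    push_cast
    ring
  rw [quditXZ, hZ, Matrix.diagonal_pow, Matrix.mul_diagonal, quditX_pow_apply,
    ZMod.natCast_zmod_val, hχ]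
  simp

theorem star_stdAddChar {D : ℕ} [NeZero D] (a : ZMod D) :
    (starRingEnd ℂ) (ZMod.stdAddChar a) = ZMod.stdAddChar (-a) :=
  (AddChar.map_neg_eq_conj _ _).symm

theorem sum_stdAddChar_mul {D : ℕ} [NeZero D] (b : ZMod D) :
    ∑ x : ZMod D, (ZMod.stdAddChar (x * b) : ℂ) = if b = 0 then (D : ℂ) else 0 := by
  rw [AddChar.sum_mulShift b (ZMod.isPrimitive_stdAddChar D)]
  simp [ZMod.card]

open scoped MatrixOrder Matrix.Norms.L2Operator in
theorem Matrix.PosSemidef.mul_comm_of_conj_mul_self {n : Type*} [Fintype n] [DecidableEq n]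
    {Q W : Matrix n n ℂ} (hQ : Q.PosSemidef) (hW : W ∈ Matrix.unitaryGroup n ℂ)
    (h : Wᴴ * (Q * Q) * W = Q * Q) : Q * W = W * Q := by
  have hW1 : Wᴴ * W = 1 := Matrix.mem_unitaryGroup_iff'.mp hW
  have hW2 : W * Wᴴ = 1 := Matrix.mem_unitaryGroup_iff.mp hW
  have hR : (Wᴴ * Q * W).PosSemidef := hQ.conjTranspose_mul_mul_same W
  have hsq : (Wᴴ * Q * W) * (Wᴴ * Q * W) = Q * Q := by
    rw [← h]
    calc _ = Wᴴ * Q * (W * Wᴴ) * Q * W := by simp only [Matrix.mul_assoc]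
      _ = _ := by rw [hW2]; simp only [Matrix.mul_assoc, Matrix.mul_one]
  have e1 := CFC.sqrt_unique hsq hR.nonneg
  have e2 := CFC.sqrt_unique (rfl : Q * Q = Q * Q) hQ.nonneg
  calc Q * W = W * Wᴴ * Q * W := by rw [hW2, Matrix.one_mul]
    _ = W * (Wᴴ * Q * W) := by simp only [Matrix.mul_assoc]
    _ = W * Q := by rw [← e1, e2]

theorem quditXZ_mem_unitaryGroup (D : ℕ) [NeZero D] (v w : ZMod D) :
    quditXZ D v w ∈ Matrix.unitaryGroup (ZMod D) ℂ := by
  rw [Matrix.mem_unitaryGroup_iff']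
  ext a b
  rw [Matrix.mul_apply, Finset.sum_eq_single (b + v)]
  · simp only [Matrix.star_apply, quditXZ_apply, add_left_inj, if_true]
    by_cases h : b = a
    · subst h
      simp [star_stdAddChar, ← AddChar.map_add_eq_mul]
    · simp [h, Ne.symm h]
  · intro c _ hc
    simp [quditXZ_apply, hc]
  · simp

theorem symmetry_mem_unitaryGroup (D : ℕ) [NeZero D] (v w v' w' : ZMod D) (θ : ℝ) :
    (quditXZ D v w).map (starRingEnd ℂ) ⊗ₖ
      (Complex.exp (θ * Complex.I) • quditXZ D v' w') ∈
        Matrix.unitaryGroup (ZMod D × ZMod D) ℂ := by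
  apply Matrix.kronecker_mem_unitary
  · have h := Matrix.mem_unitaryGroup_iff'.mp (quditXZ_mem_unitaryGroup D v w)
    have hstar : star ((quditXZ D v w).map (starRingEnd ℂ)) =
        (star (quditXZ D v w)).map (starRingEnd ℂ) := rfl
    rw [Matrix.mem_unitaryGroup_iff', hstar, ← Matrix.map_mul, h,
      Matrix.map_one _ (map_zero _) (map_one _)]
  · have h := Matrix.mem_unitaryGroup_iff'.mp (quditXZ_mem_unitaryGroup D v' w')
    rw [Matrix.mem_unitaryGroup_iff', star_smul, Matrix.smul_mul, Matrix.mul_smul, h, smul_smul]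
    have : star (Complex.exp (θ * Complex.I)) * Complex.exp (θ * Complex.I) = 1 := by
      rw [← starRingEnd_apply, ← Complex.exp_conj, ← Complex.exp_add]
      simp
    rw [this, one_smul]

theorem posSemidef_symmetry_entry {D : ℕ} [NeZero D] {d : ℕ}
    {A : Matrix (Fin d) (ZMod D × ZMod D) ℂ}
    {Q : Matrix (ZMod D × ZMod D) (ZMod D × ZMod D) ℂ}
    (hQpsd : Q.PosSemidef) (hQsq : Q * Q = Aᴴ * A) {u : Matrix (Fin d) (Fin d) ℂ}
    (hu : u ∈ Matrix.unitaryGroup (Fin d) ℂ) {v w v' w' : ZMod D} {θ : ℝ}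
    (h : u * A = A * ((quditXZ D v w).map (starRingEnd ℂ) ⊗ₖ
      (Complex.exp (θ * Complex.I) • quditXZ D v' w'))) (x y a z : ZMod D) :
    ZMod.stdAddChar (w * (x - v - a)) * Q (x, y) (a + v, z) =
      ZMod.stdAddChar (w' * (y - z)) * Q (x - v, y - v') (a, z - v') := by
  set W := (quditXZ D v w).map (starRingEnd ℂ) ⊗ₖ
    (Complex.exp (θ * Complex.I) • quditXZ D v' w') with hW
  have hcomm : Q * W = W * Q := by
    refine hQpsd.mul_comm_of_conj_mul_self (symmetry_mem_unitaryGroup D v w v' w' θ) ?_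
    have hu1 : uᴴ * u = 1 := Matrix.mem_unitaryGroup_iff'.mp hu
    calc Wᴴ * (Q * Q) * W = (A * W)ᴴ * (A * W) := by
          rw [hQsq, Matrix.conjTranspose_mul]
          simp only [Matrix.mul_assoc]
      _ = Aᴴ * (uᴴ * u) * A := by
          rw [← h, Matrix.conjTranspose_mul]
          simp only [Matrix.mul_assoc]
      _ = Q * Q := by rw [hu1, Matrix.mul_one, hQsq]
  have he := congrFun (congrFun hcomm (x, y)) (a, z - v')
  rw [Matrix.mul_apply, Matrix.mul_apply, Finset.sum_eq_single (a + v, z),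
    Finset.sum_eq_single (x - v, y - v')] at he
  · simp only [hW, Matrix.kronecker_apply, Matrix.map_apply, Matrix.smul_apply, quditXZ_apply,
      sub_add_cancel, if_true, smul_eq_mul, star_stdAddChar] at he
    have hθ := Complex.exp_ne_zero (θ * Complex.I)
    have he' : Q (x, y) (a + v, z) *
        (ZMod.stdAddChar (-(w * a)) * ZMod.stdAddChar (w' * (z - v'))) =
        ZMod.stdAddChar (-(w * (x - v))) * ZMod.stdAddChar (w' * (y - v')) *
          Q (x - v, y - v') (a, z - v') := by
      apply mul_left_cancel₀ hθ
      linear_combination he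
    have e1 : (ZMod.stdAddChar (w * (x - v - a)) : ℂ) =
        ZMod.stdAddChar (-(w * a)) * ZMod.stdAddChar (w' * (z - v')) *
          ZMod.stdAddChar (w * (x - v) - w' * (z - v')) := by
      rw [← AddChar.map_add_eq_mul, ← AddChar.map_add_eq_mul]
      congr 1
      ring
    have e2 : (ZMod.stdAddChar (w' * (y - z)) : ℂ) =
        ZMod.stdAddChar (-(w * (x - v))) * ZMod.stdAddChar (w' * (y - v')) *
          ZMod.stdAddChar (w * (x - v) - w' * (z - v')) := by
      rw [← AddChar.map_add_eq_mul, ← AddChar.map_add_eq_mul]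
      congr 1
      ring
    rw [e1, e2]
    linear_combination ZMod.stdAddChar (w * (x - v) - w' * (z - v')) * he'
  · rintro ⟨c₁, c₂⟩ _ hc
    have : ¬ (x = c₁ + v ∧ y = c₂ + v') := by
      rintro ⟨rfl, rfl⟩
      simp at hc
    rw [not_and_or] at this
    rcases this with h | h <;> simp [hW, quditXZ_apply, h]
  · simp
  · rintro ⟨c₁, c₂⟩ _ hc
    have : ¬ (c₁ = a + v ∧ c₂ = z) := by
      rintro ⟨rfl, rfl⟩
      simp at hc
    rw [not_and_or] at this
    rcases this with h | h <;> simp [hW, quditXZ_apply, h]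
  · simp

/-- The controlled Weyl–Heisenberg unitary sending a two-qudit state and the basis vector `a` to
`∑ m x, χ (-(x - a) m) / D • e_x ⊗ R (a (v₁, w₁) + m (v₂, w₂))`, where `χ` is the standard
character and `R p` the product of the Weyl–Heisenberg operator of `p` and its conjugate. -/
noncomputable def controlledWeyl (D : ℕ) [NeZero D] (v₁ w₁ v₂ w₂ : ZMod D) :
    Matrix (ZMod D × ZMod D × ZMod D) (ZMod D × ZMod D × ZMod D) ℂ :=
  Matrix.of fun p q => (D : ℂ)⁻¹ * ∑ m : ZMod D,
    if p.2.1 = q.1 + q.2.2 * v₁ + m * v₂ ∧ p.2.2 = q.2.1 + q.2.2 * v₁ + m * v₂ then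
      ZMod.stdAddChar (-((p.1 - q.2.2) * m) + (q.2.2 * w₁ + m * w₂) * (q.1 - q.2.1))
    else 0

theorem mul_quditXZ_kronecker_apply {D : ℕ} [NeZero D]
    (M : Matrix (ZMod D × ZMod D × ZMod D) (ZMod D × ZMod D × ZMod D) ℂ)
    (a₁ b₁ a₂ b₂ a₃ b₃ : ZMod D) (p q : ZMod D × ZMod D × ZMod D) :
    (M * (quditXZ D a₁ b₁ ⊗ₖ (quditXZ D a₂ b₂ ⊗ₖ quditXZ D a₃ b₃))) p q =
      M p (q.1 + a₁, q.2.1 + a₂, q.2.2 + a₃) *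
        ZMod.stdAddChar (b₁ * q.1 + b₂ * q.2.1 + b₃ * q.2.2) := by
  rw [Matrix.mul_apply, Finset.sum_eq_single (q.1 + a₁, q.2.1 + a₂, q.2.2 + a₃)]
  · simp [quditXZ_apply, AddChar.map_add_eq_mul, mul_assoc]
  · rintro ⟨c₁, c₂, c₃⟩ _ hc
    have : ¬ (c₁ = q.1 + a₁ ∧ c₂ = q.2.1 + a₂ ∧ c₃ = q.2.2 + a₃) := by
      rintro ⟨rfl, rfl, rfl⟩
      simp at hc
    rw [not_and_or, not_and_or] at this
    rcases this with h | h | h <;> simp [quditXZ_apply, h]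
  · simp

theorem quditXZ_kronecker_mul_apply {D : ℕ} [NeZero D]
    (M : Matrix (ZMod D × ZMod D × ZMod D) (ZMod D × ZMod D × ZMod D) ℂ)
    (a₁ b₁ a₂ b₂ a₃ b₃ : ZMod D) (p q : ZMod D × ZMod D × ZMod D) :
    ((quditXZ D a₁ b₁ ⊗ₖ (quditXZ D a₂ b₂ ⊗ₖ quditXZ D a₃ b₃)) * M) p q =
      ZMod.stdAddChar (b₁ * (p.1 - a₁) + b₂ * (p.2.1 - a₂) + b₃ * (p.2.2 - a₃)) *
        M (p.1 - a₁, p.2.1 - a₂, p.2.2 - a₃) q := by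
  rw [Matrix.mul_apply, Finset.sum_eq_single (p.1 - a₁, p.2.1 - a₂, p.2.2 - a₃)]
  · simp [quditXZ_apply, AddChar.map_add_eq_mul, mul_assoc]
  · rintro ⟨c₁, c₂, c₃⟩ _ hc
    have : ¬ (p.1 = c₁ + a₁ ∧ p.2.1 = c₂ + a₂ ∧ p.2.2 = c₃ + a₃) := by
      rintro ⟨h₁, h₂, h₃⟩
      simp [h₁, h₂, h₃] at hc
    rw [not_and_or, not_and_or] at this
    rcases this with h | h | h <;> simp [quditXZ_apply, h]
  · simp

theorem exists_controlledWeyl_mul (D : ℕ) [NeZero D] (v₁ w₁ v₂ w₂ a₁ b₁ a₂ b₂ a₃ b₃ : ZMod D) :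
    ∃ r₁ s₁ r₂ s₂ r₃ s₃ k : ZMod D,
      controlledWeyl D v₁ w₁ v₂ w₂ *
          (quditXZ D a₁ b₁ ⊗ₖ (quditXZ D a₂ b₂ ⊗ₖ quditXZ D a₃ b₃)) =
        ((ZMod.stdAddChar k : ℂ) •
          (quditXZ D r₁ s₁ ⊗ₖ (quditXZ D r₂ s₂ ⊗ₖ quditXZ D r₃ s₃))) *
          controlledWeyl D v₁ w₁ v₂ w₂ := by
  obtain ⟨t, ht⟩ : ∃ t, t = w₁ * (a₁ - a₂) + b₃ - (b₁ + b₂) * v₁ := ⟨_, rfl⟩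
  obtain ⟨r, hr⟩ : ∃ r, r = a₃ + w₂ * (a₁ - a₂) - (b₁ + b₂) * v₂ := ⟨_, rfl⟩
  refine ⟨r, t, a₁ + a₃ * v₁ - t * v₂, a₃ * w₁ + b₁ - t * w₂, a₂ + a₃ * v₁ - t * v₂,
    -(a₃ * w₁) + b₂ + t * w₂, a₃ * w₁ * (a₁ - a₂) - (b₁ + b₂) * v₂ * t, ?_⟩
  ext ⟨x, y, z⟩ ⟨y', z', a⟩
  rw [Matrix.smul_mul, Matrix.smul_apply, mul_quditXZ_kronecker_apply,
    quditXZ_kronecker_mul_apply, smul_eq_mul]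
  simp only [controlledWeyl, Matrix.of_apply]
  rw [mul_assoc, mul_left_comm _ (D : ℂ)⁻¹, mul_left_comm _ (D : ℂ)⁻¹]
  congr 1
  have hshift (f : ZMod D → ℂ) : ∑ m, f m = ∑ m, f (m + t) :=
    (Equiv.sum_comp (Equiv.addRight t) f).symm
  conv_rhs => rw [hshift]
  rw [← mul_assoc, Finset.sum_mul, Finset.mul_sum]
  refine Finset.sum_congr rfl fun m _ => ?_
  have hc : (y = y' + a₁ + (a + a₃) * v₁ + m * v₂ ∧ z = z' + a₂ + (a + a₃) * v₁ + m * v₂) ↔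
      (y - (a₁ + a₃ * v₁ - t * v₂) = y' + a * v₁ + (m + t) * v₂ ∧
        z - (a₂ + a₃ * v₁ - t * v₂) = z' + a * v₁ + (m + t) * v₂) := by
    constructor
    · rintro ⟨rfl, rfl⟩
      constructor <;> ring
    · rintro ⟨hy, hz⟩
      constructor
      · linear_combination hy
      · linear_combination hz
  rw [if_congr hc rfl rfl]
  split_ifs with h
  · obtain ⟨hy, hz⟩ := h
    rw [hy, hz]
    simp only [← AddChar.map_add_eq_mul]
    congr 1
    subst hr ht
    ring
  · simp

theorem controlledWeyl_mem_unitaryGroup (D : ℕ) [NeZero D] (v₁ w₁ v₂ w₂ : ZMod D) :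
    controlledWeyl D v₁ w₁ v₂ w₂ ∈ Matrix.unitaryGroup (ZMod D × ZMod D × ZMod D) ℂ := by
  have hD : (D : ℂ) ≠ 0 := NeZero.ne _
  rw [Matrix.mem_unitaryGroup_iff']
  ext ⟨y₁, z₁, a₁⟩ ⟨y₂, z₂, a₂⟩
  have hyz (x m m' : ZMod D) :
      ∑ y : ZMod D, ∑ z : ZMod D,
        (starRingEnd ℂ) (if y = y₁ + a₁ * v₁ + m * v₂ ∧ z = z₁ + a₁ * v₁ + m * v₂ then
          ZMod.stdAddChar (-((x - a₁) * m) + (a₁ * w₁ + m * w₂) * (y₁ - z₁)) else 0) *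
        (if y = y₂ + a₂ * v₁ + m' * v₂ ∧ z = z₂ + a₂ * v₁ + m' * v₂ then
          ZMod.stdAddChar (-((x - a₂) * m') + (a₂ * w₁ + m' * w₂) * (y₂ - z₂)) else 0) =
      ZMod.stdAddChar (x * (m - m')) *
        (if y₁ + a₁ * v₁ + m * v₂ = y₂ + a₂ * v₁ + m' * v₂ ∧
            z₁ + a₁ * v₁ + m * v₂ = z₂ + a₂ * v₁ + m' * v₂ then
          ZMod.stdAddChar (a₂ * m' - a₁ * m - (a₁ * w₁ + m * w₂) * (y₁ - z₁) +
            (a₂ * w₁ + m' * w₂) * (y₂ - z₂)) else 0) := by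
    rw [Finset.sum_eq_single (y₁ + a₁ * v₁ + m * v₂),
      Finset.sum_eq_single (z₁ + a₁ * v₁ + m * v₂)]
    · rw [if_pos ⟨rfl, rfl⟩, mul_ite, mul_ite, star_stdAddChar, ← AddChar.map_add_eq_mul,
        ← AddChar.map_add_eq_mul, mul_zero, mul_zero]
      congr 2
      ring
    · intro z _ hz
      simp [hz]
    · simp
    · intro y _ hy
      simp [hy]
    · simp
  have hx (m m' : ZMod D) :
      ∑ x : ZMod D, ∑ y : ZMod D, ∑ z : ZMod D,
        (starRingEnd ℂ) (if y = y₁ + a₁ * v₁ + m * v₂ ∧ z = z₁ + a₁ * v₁ + m * v₂ then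
          ZMod.stdAddChar (-((x - a₁) * m) + (a₁ * w₁ + m * w₂) * (y₁ - z₁)) else 0) *
        (if y = y₂ + a₂ * v₁ + m' * v₂ ∧ z = z₂ + a₂ * v₁ + m' * v₂ then
          ZMod.stdAddChar (-((x - a₂) * m') + (a₂ * w₁ + m' * w₂) * (y₂ - z₂)) else 0) =
      if m' = m then (D : ℂ) *
        (if y₁ + a₁ * v₁ = y₂ + a₂ * v₁ ∧ z₁ + a₁ * v₁ = z₂ + a₂ * v₁ then
          ZMod.stdAddChar (m * (a₂ - a₁)) *
            ZMod.stdAddChar (a₂ * w₁ * (y₂ - z₂) - a₁ * w₁ * (y₁ - z₁)) else 0) else 0 := by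
    simp_rw [hyz]
    rw [← Finset.sum_mul, sum_stdAddChar_mul]
    by_cases h : m' = m
    · subst h
      simp only [sub_self, if_true, add_left_inj]
      congr 1
      split_ifs with hc
      · rw [← AddChar.map_add_eq_mul]
        congr 1
        linear_combination m' * w₂ * (hc.2 - hc.1)
      · rfl
    · simp [h, sub_eq_zero, Ne.symm h]
  have hcomm (f : ZMod D → ZMod D → ZMod D → ZMod D → ℂ) :
      ∑ m, ∑ x, ∑ y, ∑ z, f m x y z = ∑ x, ∑ y, ∑ z, ∑ m, f m x y z := by
    rw [Finset.sum_comm]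
    refine Finset.sum_congr rfl fun x _ => ?_
    rw [Finset.sum_comm]
    exact Finset.sum_congr rfl fun y _ => Finset.sum_comm
  calc (star (controlledWeyl D v₁ w₁ v₂ w₂) * controlledWeyl D v₁ w₁ v₂ w₂)
        (y₁, z₁, a₁) (y₂, z₂, a₂)
      = (D : ℂ)⁻¹ * (D : ℂ)⁻¹ * ∑ m : ZMod D, ∑ m' : ZMod D, ∑ x : ZMod D, ∑ y : ZMod D,
        ∑ z : ZMod D,
        (starRingEnd ℂ) (if y = y₁ + a₁ * v₁ + m * v₂ ∧ z = z₁ + a₁ * v₁ + m * v₂ then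
          ZMod.stdAddChar (-((x - a₁) * m) + (a₁ * w₁ + m * w₂) * (y₁ - z₁)) else 0) *
        (if y = y₂ + a₂ * v₁ + m' * v₂ ∧ z = z₂ + a₂ * v₁ + m' * v₂ then
          ZMod.stdAddChar (-((x - a₂) * m') + (a₂ * w₁ + m' * w₂) * (y₂ - z₂)) else 0) := by
        rw [Finset.sum_congr rfl fun m _ => hcomm _, hcomm, Matrix.mul_apply]
        simp only [Fintype.sum_prod_type, Finset.mul_sum (s := Finset.univ (α := ZMod D)),
          Matrix.star_apply, controlledWeyl, Matrix.of_apply, map_sum, map_mul,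
          ← starRingEnd_apply, map_inv₀, map_natCast, Finset.sum_mul]
        refine Finset.sum_congr rfl fun x _ => Finset.sum_congr rfl fun y _ =>
          Finset.sum_congr rfl fun z _ => ?_
        rw [Finset.sum_comm]
        refine Finset.sum_congr rfl fun m _ => Finset.sum_congr rfl fun m' _ => ?_
        ring
    _ = (1 : Matrix (ZMod D × ZMod D × ZMod D) (ZMod D × ZMod D × ZMod D) ℂ)
        (y₁, z₁, a₁) (y₂, z₂, a₂) := by
        simp only [hx, Finset.sum_ite_eq', Finset.mem_univ, if_true]
        rw [← Finset.mul_sum]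
        by_cases hc : y₁ + a₁ * v₁ = y₂ + a₂ * v₁ ∧ z₁ + a₁ * v₁ = z₂ + a₂ * v₁
        · simp only [if_pos hc]
          rw [← Finset.sum_mul, sum_stdAddChar_mul]
          by_cases ha : a₂ = a₁
          · subst ha
            obtain ⟨hy, hz⟩ := hc
            rw [add_left_inj] at hy hz
            subst hy hz
            simp only [sub_self, if_true, AddChar.map_zero_eq_one, mul_one, Matrix.one_apply_eq]
            field_simp
          · simp [sub_eq_zero, ha, Ne.symm ha]
        · have : ¬ (y₁ = y₂ ∧ z₁ = z₂ ∧ a₁ = a₂) := by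
            rintro ⟨rfl, rfl, rfl⟩
            exact hc ⟨rfl, rfl⟩
          simp [hc, this]

theorem isClifford3_controlledWeyl (D : ℕ) [NeZero D] (v₁ w₁ v₂ w₂ : ZMod D) :
    IsClifford3 D (controlledWeyl D v₁ w₁ v₂ w₂) := by
  have hU := controlledWeyl_mem_unitaryGroup D v₁ w₁ v₂ w₂
  refine ⟨hU, ?_⟩
  rintro _ ⟨a₁, b₁, a₂, b₂, a₃, b₃, c, hc, rfl⟩
  obtain ⟨r₁, s₁, r₂, s₂, r₃, s₃, k, h⟩ :=
    exists_controlledWeyl_mul D v₁ w₁ v₂ w₂ a₁ b₁ a₂ b₂ a₃ b₃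
  refine ⟨r₁, s₁, r₂, s₂, r₃, s₃, c * ZMod.stdAddChar k, ?_, ?_⟩
  · rw [norm_mul, hc, AddChar.norm_apply, one_mul]
  · rw [Matrix.mul_smul, h, Matrix.smul_mul, Matrix.mul_assoc, ← Matrix.star_eq_conjTranspose,
      Matrix.mem_unitaryGroup_iff.mp hU, Matrix.mul_one, smul_smul]

theorem controlledWeyl_sum_eq {D : ℕ} [NeZero D]
    {Q : Matrix (ZMod D × ZMod D) (ZMod D × ZMod D) ℂ} {v₁ w₁ v₂ w₂ : ZMod D}
    (hX : ∀ x y a z, Q (x, y) (a + 1, z) =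
      ZMod.stdAddChar (w₁ * (y - z)) * Q (x - 1, y - v₁) (a, z - v₁))
    (hZ : ∀ x y a z, ZMod.stdAddChar (x - a) * Q (x, y) (a, z) =
      ZMod.stdAddChar (w₂ * (y - z)) * Q (x, y - v₂) (a, z - v₂)) (x y z a : ZMod D) :
    ∑ y' : ZMod D, ∑ z' : ZMod D, controlledWeyl D v₁ w₁ v₂ w₂ (x, y, z) (y', z', a) *
      ∑ k : ZMod D, Q (k, y') (0, z') = Q (x, y) (a, z) := by
  have hD : (D : ℂ) ≠ 0 := NeZero.ne _
  have hXn (n : ℕ) (x y z : ZMod D) : Q (x, y) ((n : ZMod D), z) =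
      ZMod.stdAddChar ((n : ZMod D) * w₁ * (y - z)) * Q (x - n, y - n * v₁) (0, z - n * v₁) := by
    induction n generalizing x y z with
    | zero => simp
    | succ n ih =>
      push_cast
      rw [hX, ih, ← mul_assoc, ← AddChar.map_add_eq_mul]
      ring_nf
  have hZn (n : ℕ) (x y a z : ZMod D) : ZMod.stdAddChar ((x - a) * (n : ZMod D)) * Q (x, y) (a, z) =
      ZMod.stdAddChar ((n : ZMod D) * w₂ * (y - z)) * Q (x, y - n * v₂) (a, z - n * v₂) := by
    induction n generalizing y z with
    | zero => simp
    | succ n ih =>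
      push_cast
      rw [mul_add, mul_one, AddChar.map_add_eq_mul, mul_assoc, hZ, mul_left_comm, ih,
        ← mul_assoc, ← AddChar.map_add_eq_mul]
      ring_nf
  have hXa := hXn a.val
  simp only [ZMod.natCast_zmod_val] at hXa
  have hZm (m : ZMod D) := hZn m.val
  simp only [ZMod.natCast_zmod_val] at hZm
  have hyz (m : ZMod D) : ∑ y' : ZMod D, ∑ z' : ZMod D,
      (if y = y' + a * v₁ + m * v₂ ∧ z = z' + a * v₁ + m * v₂ then
        (ZMod.stdAddChar (-((x - a) * m) + (a * w₁ + m * w₂) * (y' - z')) : ℂ) else 0) *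
        ∑ k : ZMod D, Q (k, y') (0, z') =
      ∑ k : ZMod D, ZMod.stdAddChar (m * (k - (x - a))) *
        (ZMod.stdAddChar (a * w₁ * (y - z)) * Q (k, y - a * v₁) (0, z - a * v₁)) := by
    rw [Finset.sum_eq_single (y - a * v₁ - m * v₂), Finset.sum_eq_single (z - a * v₁ - m * v₂)]
    · rw [if_pos ⟨by ring, by ring⟩, Finset.mul_sum]
      refine Finset.sum_congr rfl fun k _ => ?_
      have h := hZm m k (y - a * v₁) 0 (z - a * v₁)
      rw [sub_zero] at h
      have e1 : (ZMod.stdAddChar (-((x - a) * m) + (a * w₁ + m * w₂) *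
          (y - a * v₁ - m * v₂ - (z - a * v₁ - m * v₂))) : ℂ) =
          ZMod.stdAddChar (-((x - a) * m) + a * w₁ * (y - z)) *
            ZMod.stdAddChar (m * w₂ * (y - a * v₁ - (z - a * v₁))) := by
        rw [← AddChar.map_add_eq_mul]
        congr 1
        ring
      rw [e1, mul_assoc, ← h, ← mul_assoc, ← mul_assoc, ← AddChar.map_add_eq_mul,
        ← AddChar.map_add_eq_mul]
      congr 2
      ring
    · intro z' _ hz
      rw [if_neg, zero_mul]
      rintro ⟨-, h⟩
      exact hz (by rw [h]; ring)
    · simp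
    · intro y' _ hy
      refine Finset.sum_eq_zero fun z' _ => ?_
      rw [if_neg, zero_mul]
      rintro ⟨h, -⟩
      exact hy (by rw [h]; ring)
    · simp
  calc _ = (D : ℂ)⁻¹ * ∑ m : ZMod D, ∑ y' : ZMod D, ∑ z' : ZMod D,
      (if y = y' + a * v₁ + m * v₂ ∧ z = z' + a * v₁ + m * v₂ then
        (ZMod.stdAddChar (-((x - a) * m) + (a * w₁ + m * w₂) * (y' - z')) : ℂ) else 0) *
        ∑ k : ZMod D, Q (k, y') (0, z') := by
        simp only [controlledWeyl, Matrix.of_apply]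
        conv_rhs => rw [Finset.sum_comm, Finset.mul_sum]
        refine Finset.sum_congr rfl fun y' _ => ?_
        conv_rhs => rw [Finset.sum_comm, Finset.mul_sum]
        refine Finset.sum_congr rfl fun z' _ => ?_
        rw [mul_assoc, Finset.sum_mul]
    _ = _ := by
        simp_rw [hyz]
        rw [Finset.sum_comm]
        simp_rw [← Finset.sum_mul, sum_stdAddChar_mul, sub_eq_zero, ite_mul, zero_mul]
        rw [Finset.sum_ite_eq' Finset.univ, if_pos (Finset.mem_univ _), inv_mul_cancel_left₀ hD, hXa]

/-- **Clifford structure of MF MPS.**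
Let `A` be an MPS tensor with the Weyl–Heisenberg MF symmetry and `Q` the
positive semidefinite square root of `Aᴴ * A`.  Then the sideways reshuffle
`V_Q (a', b', b) a := Q (a', b') (a, b)` is proportional to a 3-qudit Clifford
unitary applied to a fixed (possibly magic) unit state `ψ` tensored with the
identity on the virtual input. -/
theorem mf_mps_clifford_structure (D d : ℕ) [NeZero D] (hd : 1 ≤ d)
    (A : Matrix (Fin d) (ZMod D × ZMod D) ℂ)
    (hsym : ∀ v w : ZMod D, ∃ u ∈ Matrix.unitaryGroup (Fin d) ℂ,
      ∃ (v' w' : ZMod D) (θ : ℝ),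
        u * A = A * ((quditXZ D v w).map (starRingEnd ℂ) ⊗ₖ
          (Complex.exp (θ * Complex.I) • quditXZ D v' w')))
    (Q : Matrix (ZMod D × ZMod D) (ZMod D × ZMod D) ℂ)
    (hQpsd : Q.PosSemidef) (hQsq : Q * Q = Aᴴ * A) :
    ∃ c : ℝ, 0 ≤ c ∧ ∃ U, IsClifford3 D U ∧
      ∃ ψ : ZMod D × ZMod D → ℂ, (∑ p, ‖ψ p‖ ^ 2 = 1) ∧
      ∀ x y z a : ZMod D,
        Q (x, y) (a, z)
          = (c : ℂ) * ∑ x' : ZMod D, ∑ y' : ZMod D,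
              U (x, y, z) (x', y', a) * ψ (x', y') := by
  obtain ⟨u₁, hu₁, v₁, w₁, θ₁, h₁⟩ := hsym 1 0
  obtain ⟨u₂, hu₂, v₂, w₂, θ₂, h₂⟩ := hsym 0 1
  have hX := posSemidef_symmetry_entry hQpsd hQsq hu₁ h₁
  have hZ := posSemidef_symmetry_entry hQpsd hQsq hu₂ h₂
  simp only [zero_mul, AddChar.map_zero_eq_one, one_mul] at hX
  simp only [one_mul, sub_zero, add_zero] at hZ
  have hsum := controlledWeyl_sum_eq hX hZ
  have hU := isClifford3_controlledWeyl D v₁ w₁ v₂ w₂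
  set φ : ZMod D × ZMod D → ℂ := fun p => ∑ k : ZMod D, Q (k, p.1) (0, p.2) with hφ
  have hN : 0 ≤ ∑ p, ‖φ p‖ ^ 2 := Finset.sum_nonneg fun p _ => by positivity
  rcases hN.eq_or_lt with h0 | hpos
  · refine ⟨0, le_rfl, _, hU, Pi.single 0 1, ?_, fun x y z a => ?_⟩
    · rw [Finset.sum_eq_single 0]
      · simp
      · intro p _ hp
        simp [hp]
      · simp
    · have hφ0 (p : ZMod D × ZMod D) : φ p = 0 := by
        have h := (Finset.sum_eq_zero_iff_of_nonneg fun p _ => by positivity).mp h0.symm p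
          (Finset.mem_univ p)
        simpa using h
      have hφ0' (y z : ZMod D) : ∑ k : ZMod D, Q (k, y) (0, z) = 0 := hφ0 (y, z)
      rw [← hsum]
      simp [hφ0']
  · set c := Real.sqrt (∑ p, ‖φ p‖ ^ 2) with hc
    have hcpos : 0 < c := Real.sqrt_pos.mpr hpos
    have hc0 : (c : ℂ) ≠ 0 := by exact_mod_cast hcpos.ne'
    refine ⟨c, hcpos.le, _, hU, fun p => (c : ℂ)⁻¹ * φ p, ?_, fun x y z a => ?_⟩
    · simp only [norm_mul, mul_pow, ← Finset.mul_sum]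
      rw [← Real.sq_sqrt hN, ← hc]
      simp [hcpos.ne']
    · rw [← hsum, Finset.mul_sum]
      refine Finset.sum_congr rfl fun y' _ => ?_
      rw [Finset.mul_sum]
      refine Finset.sum_congr rfl fun z' _ => ?_
      rw [mul_left_comm, mul_inv_cancel_left₀ hc0]
end

section
/- Fix D ≥ 1, d ≥ 1, and let A : Matrix (Fin d) ((ZMod D) × (ZMod D) × (ZMod D) × (ZMod D)) ℂ be a PEPS tensor (virtual indices ordered (left, top, right, bottom)) with the Weyl–Heisenberg PEPS MF symmetry: for every (v, w) ∈ ZMod D × ZMod D there exist a unitary u ∈ Matrix (Fin d) (Fin d) ℂ and elements W₁, W₂ of the single-qudit Weyl–Heisenberg group 𝒲₁ with u * A = A * (conj(X^v * Z^w) ⊗ₖ W₁ ⊗ₖ W₂ ⊗ₖ 1), and likewise for every (v, w) there exist a unitary u and W₁', W₂' ∈ 𝒲₁ with u * A = A * (1 ⊗ₖ W₁' ⊗ₖ W₂' ⊗ₖ conj(X^v * Z^w)). Let Q be the positive semidefinite square root of Aᴴ * A, and define the sideways reshuffle V_Q : Matrix ((ZMod D)⁶) ((ZMod D)²) ℂ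 by V_Q (p₁, p₂, p₃, p₄, t, r) (l, b) := Q (p₁, p₂, p₃, p₄) (l, t, r, b). Then there exist c ≥ 0, a Clifford unitary U_C on 6 qudits, and a vector ψ : (ZMod D)⁴ → ℂ with unit ℓ²-norm such that for all indices: V_Q (p₁, p₂, p₃, p₄, t, r) (l, b) = c * Σ_{q₁, q₂, q₃, q₄ : ZMod D} U_C (p₁, p₂, p₃, p₄, t, r) (q₁, q₂, q₃, q₄, l, b) * ψ (q₁, q₂, q₃, q₄). -/
open Matrix Kronecker ComplexOrder

/-- The single-qudit Weyl–Heisenberg group `𝒲₁`. -/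
noncomputable def weylHeisenberg1 (D : ℕ) [NeZero D] :
    Set (Matrix (ZMod D) (ZMod D) ℂ) :=
  {M | ∃ (a b : ZMod D) (c : ℂ), ‖c‖ = 1 ∧ M = c • quditXZ D a b}

/-- The 6-qudit Weyl–Heisenberg group, on the index type
`ZMod D × ZMod D × ZMod D × ZMod D × ZMod D × ZMod D`. -/
noncomputable def weylHeisenberg6 (D : ℕ) [NeZero D] :
    Set (Matrix (ZMod D × ZMod D × ZMod D × ZMod D × ZMod D × ZMod D)
      (ZMod D × ZMod D × ZMod D × ZMod D × ZMod D × ZMod D) ℂ) :=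
  {M | ∃ (a₁ b₁ a₂ b₂ a₃ b₃ a₄ b₄ a₅ b₅ a₆ b₆ : ZMod D) (c : ℂ),
    ‖c‖ = 1 ∧
    M = c • (quditXZ D a₁ b₁ ⊗ₖ (quditXZ D a₂ b₂ ⊗ₖ (quditXZ D a₃ b₃ ⊗ₖ
      (quditXZ D a₄ b₄ ⊗ₖ (quditXZ D a₅ b₅ ⊗ₖ quditXZ D a₆ b₆)))))}

/-- A Clifford unitary on 6 qudits. -/
noncomputable def IsClifford6 (D : ℕ) [NeZero D]
    (U : Matrix (ZMod D × ZMod D × ZMod D × ZMod D × ZMod D × ZMod D)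
      (ZMod D × ZMod D × ZMod D × ZMod D × ZMod D × ZMod D) ℂ) : Prop :=
  U ∈ Matrix.unitaryGroup (ZMod D × ZMod D × ZMod D × ZMod D × ZMod D × ZMod D) ℂ ∧
    ∀ w ∈ weylHeisenberg6 D, U * w * Uᴴ ∈ weylHeisenberg6 D

open ZMod (stdAddChar)

section Weyl

variable {D : ℕ} [NeZero D] {R : Type*} [CommRing R] [Algebra (ZMod D) R] [DecidableEq R]

lemma conj_stdAddChar (x : ZMod D) :
    (starRingEnd ℂ) (stdAddChar x) = stdAddChar (-x) := by
  rw [AddChar.map_neg_eq_conj]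

lemma norm_stdAddChar (x : ZMod D) : ‖(stdAddChar x : ℂ)‖ = 1 := AddChar.norm_apply _ _

/-- The Weyl operator with shift part `x.1` and clock part `x.2` on functions on a finite ring,
with respect to the additive character `stdAddChar ∘ tr`. -/
noncomputable def weyl (tr : R →ₗ[ZMod D] ZMod D) (x : R × R) : Matrix R R ℂ :=
  Matrix.of fun i j => if i = j + x.1 then stdAddChar (tr (x.2 * j)) else 0

/-- The symplectic form governing the commutation of Weyl operators. -/
def symp (tr : R →ₗ[ZMod D] ZMod D) (x y : R × R) : ZMod D := tr (x.2 * y.1) - tr (y.2 * x.1)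

variable (tr : R →ₗ[ZMod D] ZMod D)

lemma weyl_zero : weyl tr 0 = 1 := by
  ext i j
  simp [weyl, Matrix.one_apply]

lemma weyl_conjTranspose (x : R × R) :
    (weyl tr x)ᴴ = (stdAddChar (tr (x.2 * x.1)) : ℂ) • weyl tr (-x) := by
  ext i j
  simp only [weyl, Matrix.conjTranspose_apply, Matrix.of_apply, Matrix.smul_apply, smul_eq_mul,
    Prod.fst_neg, Prod.snd_neg, mul_ite, mul_zero, ← AddChar.map_add_eq_mul, ← map_add,
    apply_ite star, star_zero]
  by_cases h : j = i + x.1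
  · subst h
    simp only [add_neg_cancel_right, if_true]
    rw [← starRingEnd_apply, conj_stdAddChar, ← map_neg]
    congr 2
    ring
  · rw [if_neg h, if_neg]
    rintro rfl
    simp at h

variable [Fintype R]

lemma weyl_mul_apply {m : Type*} (x : R × R) (M : Matrix R m ℂ) (i : R) (j : m) :
    (weyl tr x * M) i j = stdAddChar (tr (x.2 * (i - x.1))) * M (i - x.1) j := by
  simp [weyl, Matrix.mul_apply, ← sub_eq_iff_eq_add]

lemma mul_weyl_apply {m : Type*} (x : R × R) (M : Matrix m R ℂ) (i : m) (j : R) :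
    (M * weyl tr x) i j = M i (j + x.1) * stdAddChar (tr (x.2 * j)) := by
  simp [weyl, Matrix.mul_apply]

lemma weyl_mul_weyl (x y : R × R) :
    weyl tr x * weyl tr y = (stdAddChar (tr (x.2 * y.1)) : ℂ) • weyl tr (x + y) := by
  ext i j
  rw [mul_weyl_apply]
  simp only [weyl, Matrix.of_apply, Matrix.smul_apply, smul_eq_mul, Prod.fst_add, Prod.snd_add,
    ite_mul, mul_ite, zero_mul, mul_zero, ← AddChar.map_add_eq_mul, ← map_add]
  refine if_congr (by rw [add_assoc, add_comm x.1]) ?_ rfl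
  congr 2
  ring

lemma weyl_mul_weyl_comm (x y : R × R) :
    weyl tr x * weyl tr y = (stdAddChar (symp tr x y) : ℂ) • (weyl tr y * weyl tr x) := by
  rw [weyl_mul_weyl, weyl_mul_weyl, smul_smul, ← AddChar.map_add_eq_mul, symp, sub_add_cancel,
    add_comm x y]

lemma weyl_conjTranspose_mul_self (x : R × R) : (weyl tr x)ᴴ * weyl tr x = 1 := by
  rw [weyl_conjTranspose, smul_mul_assoc, weyl_mul_weyl, smul_smul, ← AddChar.map_add_eq_mul,
    neg_add_cancel, weyl_zero]
  simp

lemma weyl_pow (x : R × R) (k : ℕ) :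
    ∃ c : ℂ, ‖c‖ = 1 ∧ weyl tr x ^ k = c • weyl tr ((k : ZMod D) • x) := by
  induction k with
  | zero => exact ⟨1, by simp, by simp [weyl_zero]⟩
  | succ k ih =>
    obtain ⟨c, hc, h⟩ := ih
    refine ⟨c * stdAddChar (tr (((k : ZMod D) • x).2 * x.1)), by simp [hc], ?_⟩
    rw [pow_succ, h, smul_mul_assoc, weyl_mul_weyl, smul_smul]
    congr 2
    push_cast
    rw [add_smul, one_smul]

/-- A multiple of a Weyl operator generates a unitary representation of `ZMod D`. -/
lemma exists_weyl_rep (x : R × R) :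
    ∃ e : ZMod D → Matrix R R ℂ, (∀ s t, e (s + t) = e s * e t) ∧ e 0 = 1 ∧
      (∀ s, (e s)ᴴ * e s = 1) ∧ ∀ s, ∃ c : ℂ, ‖c‖ = 1 ∧ e s = c • weyl tr (s • x) := by
  obtain ⟨c, hc, h⟩ := weyl_pow tr x D
  have hD : D ≠ 0 := NeZero.ne D
  obtain ⟨z, hz⟩ := IsAlgClosed.exists_pow_nat_eq c⁻¹ (Nat.pos_of_ne_zero hD)
  have hz1 : ‖z‖ = 1 := by
    rw [← pow_eq_one_iff_of_nonneg (norm_nonneg z) hD, ← norm_pow, hz, norm_inv, hc, inv_one]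
  have hc0 : c ≠ 0 := by
    rintro rfl
    simp at hc
  have hN : (z • weyl tr x) ^ D = 1 := by
    rw [smul_pow, h, hz, smul_smul, inv_mul_cancel₀ hc0]
    simp [weyl_zero]
  have hw (s : ZMod D) :
      ∃ c : ℂ, ‖c‖ = 1 ∧ (z • weyl tr x) ^ s.val = c • weyl tr (s • x) := by
    obtain ⟨c, hc, h⟩ := weyl_pow tr x s.val
    refine ⟨z ^ s.val * c, by simp [hz1, hc], ?_⟩
    rw [smul_pow, h, smul_smul, ZMod.natCast_zmod_val]
  refine ⟨fun s => (z • weyl tr x) ^ s.val, fun s t => ?_, by simp, fun s => ?_, hw⟩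
  · simp only
    rw [ZMod.val_add, ← pow_eq_pow_mod _ hN, pow_add]
  · obtain ⟨c, hc, h⟩ := hw s
    simp only
    rw [h, conjTranspose_smul, smul_mul_smul_comm, weyl_conjTranspose_mul_self, Complex.star_def,
      ← Complex.normSq_eq_conj_mul_self, Complex.normSq_eq_norm_sq, hc]
    simp

end Weyl

section Chirp

variable {D : ℕ} [NeZero D] {n : Type*} [Fintype n] [DecidableEq n]

/-- The quadratic Gauss sum of a representation of `ZMod D × ZMod D`. -/
noncomputable def chirp (e : ZMod D × ZMod D → Matrix n n ℂ) : Matrix n n ℂ :=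
  (D : ℂ)⁻¹ • ∑ p : ZMod D × ZMod D, (stdAddChar (p.1 * p.2) : ℂ) • e p

lemma sum_stdAddChar_bilin (x : ZMod D × ZMod D) :
    ∑ p : ZMod D × ZMod D, (stdAddChar (p.1 * x.2 + p.2 * x.1) : ℂ) =
      if x = 0 then (D : ℂ) ^ 2 else 0 := by
  have h (b : ZMod D) : ∑ s : ZMod D, (stdAddChar (s * b) : ℂ) = if b = 0 then (D : ℂ) else 0 := by
    rw [AddChar.sum_mulShift b (ZMod.isPrimitive_stdAddChar D), ZMod.card]
    split_ifs <;> simp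
  simp_rw [AddChar.map_add_eq_mul, Fintype.sum_prod_type, ← Finset.mul_sum, ← Finset.sum_mul, h,
    Prod.ext_iff, Prod.fst_zero, Prod.snd_zero]
  by_cases h1 : x.1 = 0 <;> by_cases h2 : x.2 = 0 <;> simp [h1, h2, sq]

lemma chirp_mem_unitaryGroup {e : ZMod D × ZMod D → Matrix n n ℂ}
    (hadd : ∀ p q, e (p + q) = e p * e q) (h0 : e 0 = 1) (hstar : ∀ p, (e p)ᴴ = e (-p)) :
    chirp e ∈ Matrix.unitaryGroup n ℂ := by
  have hD : (D : ℂ) ≠ 0 := NeZero.ne _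
  rw [Matrix.mem_unitaryGroup_iff', star_eq_conjTranspose, chirp, conjTranspose_smul,
    conjTranspose_sum, smul_mul_smul_comm, Finset.sum_mul_sum]
  have key (p : ZMod D × ZMod D) :
      ∑ q, ((stdAddChar (p.1 * p.2) : ℂ) • e p)ᴴ * ((stdAddChar (q.1 * q.2) : ℂ) • e q) =
        ∑ x : ZMod D × ZMod D,
          ((stdAddChar (p.1 * x.2 + p.2 * x.1) : ℂ) * stdAddChar (x.1 * x.2)) • e x := by
    refine Fintype.sum_equiv (Equiv.subRight p) _ _ fun q => ?_
    rw [conjTranspose_smul, hstar, smul_mul_smul_comm, ← hadd, ← starRingEnd_apply,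
      conj_stdAddChar, ← AddChar.map_add_eq_mul, ← AddChar.map_add_eq_mul, neg_add_eq_sub (p : ZMod D × ZMod D)]
    change _ = (stdAddChar (p.1 * (q - p).2 + p.2 * (q - p).1 + (q - p).1 * (q - p).2) : ℂ) •
      e (q - p)
    congr 2
    simp only [Prod.fst_sub, Prod.snd_sub]
    ring
  simp_rw [key]
  rw [Finset.sum_comm]
  simp_rw [← Finset.sum_smul, ← Finset.sum_mul, sum_stdAddChar_bilin]
  simp [ite_smul, h0, smul_smul, hD, ← sq]

lemma chirp_mul {e : ZMod D × ZMod D → Matrix n n ℂ}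
    (hadd : ∀ p q, e (p + q) = e p * e q) {P : Matrix n n ℂ} {a b : ZMod D}
    (hP : ∀ p, e p * P = (stdAddChar (a * p.1 + b * p.2) : ℂ) • (P * e p)) :
    chirp e * P = (stdAddChar (-(a * b)) : ℂ) • (P * e (-b, -a) * chirp e) := by
  rw [chirp, smul_mul_assoc, mul_smul_comm, smul_comm, Finset.sum_mul, Finset.mul_sum]
  congr 1
  rw [Finset.smul_sum]
  refine Fintype.sum_equiv (Equiv.addRight (b, a)) _ _ fun p => ?_
  change _ = _ • (P * e (-b, -a) * ((stdAddChar ((p + (b, a)).1 * (p + (b, a)).2) : ℂ) •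
    e (p + (b, a))))
  rw [smul_mul_assoc, hP, smul_smul, mul_smul_comm, smul_smul,
    ← AddChar.map_add_eq_mul, ← AddChar.map_add_eq_mul, mul_assoc, ← hadd]
  have : ((-b, -a) : ZMod D × ZMod D) + (p + (b, a)) = p := by ext <;> simp
  rw [this]
  congr 2
  simp only [Prod.fst_add, Prod.snd_add]
  ring

end Chirp

section WeylConj

variable {D : ℕ} [NeZero D] {R : Type*} [CommRing R] [Algebra (ZMod D) R] [DecidableEq R]
  [Fintype R] (tr : R →ₗ[ZMod D] ZMod D)

/-- Conjugation by `U` sends the Weyl operator of `x` to that of `y`, up to a phase. -/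
def WeylConj (U : Matrix R R ℂ) (x y : R × R) : Prop :=
  ∃ c : ℂ, ‖c‖ = 1 ∧ U * weyl tr x = c • (weyl tr y * U)

lemma WeylConj.mul {tr : R →ₗ[ZMod D] ZMod D} {U U' : Matrix R R ℂ} {x y z : R × R}
    (h' : WeylConj tr U' y z) (h : WeylConj tr U x y) : WeylConj tr (U' * U) x z := by
  obtain ⟨c, hc, h⟩ := h
  obtain ⟨c', hc', h'⟩ := h'
  refine ⟨c * c', by simp [hc, hc'], ?_⟩
  rw [mul_assoc, h, mul_smul_comm, ← mul_assoc, h', smul_mul_assoc, smul_smul, mul_assoc]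

/-- The unitary implementing `x ↦ x - symp u x • m - symp m x • u` for commuting `m` and `u`. -/
lemma exists_transvection (m u : R × R) (hmu : symp tr m u = 0) :
    ∃ C ∈ Matrix.unitaryGroup R ℂ,
      ∀ x, WeylConj tr C x (x - symp tr u x • m - symp tr m x • u) := by
  obtain ⟨f, fadd, f0, funit, fweyl⟩ := exists_weyl_rep tr m
  obtain ⟨g, gadd, g0, gunit, gweyl⟩ := exists_weyl_rep tr u
  have symp_smul (s : ZMod D) (x y : R × R) : symp tr (s • x) y = s * symp tr x y := by
    simp [symp, mul_sub]
  have symp_smul' (s : ZMod D) (x y : R × R) : symp tr x (s • y) = s * symp tr x y := by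
    simp [symp, mul_sub]
  have fcomm (s : ZMod D) (x : R × R) :
      f s * weyl tr x = (stdAddChar (s * symp tr m x) : ℂ) • (weyl tr x * f s) := by
    obtain ⟨c, -, h⟩ := fweyl s
    rw [h, smul_mul_assoc, weyl_mul_weyl_comm, mul_smul_comm, smul_comm, symp_smul]
  have gcomm (s : ZMod D) (x : R × R) :
      g s * weyl tr x = (stdAddChar (s * symp tr u x) : ℂ) • (weyl tr x * g s) := by
    obtain ⟨c, -, h⟩ := gweyl s
    rw [h, smul_mul_assoc, weyl_mul_weyl_comm, mul_smul_comm, smul_comm, symp_smul]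
  have fg (s t : ZMod D) : f s * g t = g t * f s := by
    obtain ⟨c, -, h⟩ := gweyl t
    rw [h, mul_smul_comm, fcomm, symp_smul', hmu]
    simp
  have star_eq {h : ZMod D → Matrix R R ℂ} (hadd : ∀ s t, h (s + t) = h s * h t) (h0 : h 0 = 1)
      (hu : ∀ s, (h s)ᴴ * h s = 1) (s : ZMod D) : (h s)ᴴ = h (-s) :=
    left_inv_eq_right_inv (hu s) (by rw [← hadd, add_neg_cancel, h0])
  set e : ZMod D × ZMod D → Matrix R R ℂ := fun p => f p.1 * g p.2 with he
  have eadd (p q : ZMod D × ZMod D) : e (p + q) = e p * e q := by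
    simp only [he, Prod.fst_add, Prod.snd_add, fadd, gadd]
    rw [mul_assoc, mul_assoc, ← mul_assoc (f q.1), fg q.1 p.2, mul_assoc]
  have emul (p : ZMod D × ZMod D) (x : R × R) : e p * weyl tr x =
      (stdAddChar (symp tr m x * p.1 + symp tr u x * p.2) : ℂ) • (weyl tr x * e p) := by
    simp only [he]
    rw [mul_assoc, gcomm, mul_smul_comm, ← mul_assoc, fcomm, smul_mul_assoc, smul_smul,
      ← AddChar.map_add_eq_mul, mul_assoc, add_comm, mul_comm p.1, mul_comm p.2]
  refine ⟨chirp e, chirp_mem_unitaryGroup eadd (by simp [he, f0, g0]) fun p => ?_, fun x => ?_⟩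
  · simp only [he]
    rw [conjTranspose_mul, star_eq fadd f0 funit, star_eq gadd g0 gunit, ← fg]
    rfl
  · obtain ⟨c, hc, hf⟩ := fweyl (-symp tr u x)
    obtain ⟨c', hc', hg⟩ := gweyl (-symp tr m x)
    have := chirp_mul eadd fun p => emul p x
    simp only [he] at this
    rw [hf, hg, smul_mul_smul_comm, weyl_mul_weyl, smul_smul, mul_smul_comm, weyl_mul_weyl,
      smul_smul, smul_mul_assoc, smul_smul] at this
    have hx : x + (-symp tr u x • m + -symp tr m x • u) =
        x - symp tr u x • m - symp tr m x • u := by module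
    rw [hx] at this
    exact ⟨_, by simp [hc, hc'], this⟩

end WeylConj

section WeylConj

variable {D : ℕ} [NeZero D] {R : Type*} [CommRing R] [Algebra (ZMod D) R] [DecidableEq R]
  [Fintype R] (tr : R →ₗ[ZMod D] ZMod D)

lemma weyl_mem_unitaryGroup (x : R × R) : weyl tr x ∈ Matrix.unitaryGroup R ℂ := by
  rw [Matrix.mem_unitaryGroup_iff', star_eq_conjTranspose, weyl_conjTranspose_mul_self]

lemma weylConj_weyl (x y : R × R) : WeylConj tr (weyl tr y) x x :=
  ⟨_, norm_stdAddChar _, weyl_mul_weyl_comm tr y x⟩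

/-- A trace-preserving ring automorphism permutes the Weyl operators. -/
lemma exists_permutation (e : R ≃+* R) (he : ∀ x, tr (e x) = tr x) :
    ∃ U ∈ Matrix.unitaryGroup R ℂ, ∀ x : R × R, WeylConj tr U x (e x.1, e x.2) := by
  refine ⟨(1 : Matrix R R ℂ).submatrix e.symm id, ?_, fun x => ⟨1, by simp, ?_⟩⟩
  · rw [Matrix.mem_unitaryGroup_iff]
    ext i j
    simp [Matrix.mul_apply, Matrix.one_apply, eq_comm]
  · ext i j
    rw [mul_weyl_apply, one_smul, weyl_mul_apply]
    simp only [submatrix_apply, id, one_apply, map_sub, RingEquiv.symm_apply_apply,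
      sub_eq_iff_eq_add, ite_mul, mul_ite, one_mul, mul_one, zero_mul, mul_zero]
    refine ite_congr rfl (fun h => ?_) fun _ => rfl
    obtain rfl : i = e (j + x.1) := by rw [← h, RingEquiv.apply_symm_apply]
    rw [map_add, add_sub_cancel_right, ← map_mul, he]

/-- A Weyl symmetry of `Q` shifts both of its indices, up to a character of their difference. -/
lemma apply_add_of_commute_weyl {x : R × R} {Q : Matrix R R ℂ}
    (h : weyl tr x * Q = Q * weyl tr x) (i j : R) :
    Q (i + x.1) (j + x.1) = stdAddChar (tr (x.2 * (i - j))) * Q i j := by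
  have := congrFun₂ h (i + x.1) j
  rw [weyl_mul_apply, mul_weyl_apply, add_sub_cancel_right] at this
  rw [mul_sub, map_sub, sub_eq_add_neg, AddChar.map_add_eq_mul, mul_right_comm, this, mul_assoc,
    ← AddChar.map_add_eq_mul]
  simp

end WeylConj

section Qudits

variable {D : ℕ}

/-- The sum of the coordinates on two qudits. -/
def tr2 (D : ℕ) : ZMod D × ZMod D →ₗ[ZMod D] ZMod D := LinearMap.id.coprod LinearMap.id

/-- The sum of the coordinates on four qudits. -/
def tr4 (D : ℕ) : ZMod D × ZMod D × ZMod D × ZMod D →ₗ[ZMod D] ZMod D :=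
  LinearMap.id.coprod (LinearMap.id.coprod (tr2 D))

/-- The sum of the coordinates on six qudits. -/
def tr6 (D : ℕ) :
    ZMod D × ZMod D × ZMod D × ZMod D × ZMod D × ZMod D →ₗ[ZMod D] ZMod D :=
  LinearMap.id.coprod (LinearMap.id.coprod (tr4 D))

lemma tr2_apply (x : ZMod D × ZMod D) : tr2 D x = x.1 + x.2 := rfl

lemma tr4_apply (x : ZMod D × ZMod D × ZMod D × ZMod D) :
    tr4 D x = x.1 + (x.2.1 + (x.2.2.1 + x.2.2.2)) := rfl

lemma tr6_apply (x : ZMod D × ZMod D × ZMod D × ZMod D × ZMod D × ZMod D) :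
    tr6 D x = x.1 + (x.2.1 + (x.2.2.1 + (x.2.2.2.1 + (x.2.2.2.2.1 + x.2.2.2.2.2)))) := rfl

variable [NeZero D]

lemma exp_pow_val (b : ZMod D) :
    Complex.exp (2 * Real.pi * Complex.I / D) ^ b.val = stdAddChar b := by
  conv_rhs => rw [← ZMod.natCast_zmod_val b, ← Int.cast_natCast, ZMod.stdAddChar_coe]
  rw [← Complex.exp_nat_mul]
  congr 1
  push_cast
  ring

lemma quditX_pow (k : ℕ) :
    quditX D ^ k = Matrix.of fun a b => if a = b + (k : ZMod D) then 1 else 0 := by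
  induction k with
  | zero =>
    ext a b
    simp [Matrix.one_apply]
  | succ k ih =>
    ext a b
    rw [pow_succ, ih]
    simp [quditX, Matrix.mul_apply, add_assoc, add_comm (1 : ZMod D)]

lemma quditZ_pow (k : ℕ) :
    quditZ D ^ k = Matrix.diagonal fun b => (stdAddChar ((k : ZMod D) * b) : ℂ) := by
  have : quditZ D = Matrix.diagonal fun b => (stdAddChar b : ℂ) := by
    ext a b
    by_cases h : a = b <;> simp [quditZ, Matrix.diagonal, h, exp_pow_val]
  rw [this, Matrix.diagonal_pow]
  congr
  ext b
  rw [Pi.pow_apply, ← AddChar.map_nsmul_eq_pow, nsmul_eq_mul]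

lemma quditXZ_eq_weyl (a b : ZMod D) :
    quditXZ D a b = weyl (LinearMap.id : ZMod D →ₗ[ZMod D] ZMod D) (a, b) := by
  ext i j
  rw [quditXZ, quditX_pow, quditZ_pow, Matrix.mul_diagonal]
  simp [weyl]

lemma map_conj_weyl {R : Type*} [CommRing R] [Algebra (ZMod D) R] [DecidableEq R]
    (tr : R →ₗ[ZMod D] ZMod D) (x : R × R) :
    (weyl tr x).map (starRingEnd ℂ) = weyl tr (x.1, -x.2) := by
  ext i j
  simp [weyl, apply_ite (starRingEnd ℂ), conj_stdAddChar]

lemma weyl_kronecker_weyl {R S : Type*} [CommRing R] [Algebra (ZMod D) R] [DecidableEq R]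
    [CommRing S] [Algebra (ZMod D) S] [DecidableEq S] (tr : R →ₗ[ZMod D] ZMod D)
    (tr' : S →ₗ[ZMod D] ZMod D) (x : R × R) (y : S × S) :
    weyl tr x ⊗ₖ weyl tr' y = weyl (tr.coprod tr') ((x.1, y.1), (x.2, y.2)) := by
  ext ⟨i, i'⟩ ⟨j, j'⟩
  simp only [weyl, Matrix.kroneckerMap_apply, Matrix.of_apply, Prod.mk_add_mk, Prod.mk.injEq,
    Prod.mk_mul_mk, LinearMap.coprod_apply, AddChar.map_add_eq_mul, ite_and]
  split_ifs <;> simp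

lemma mem_weylHeisenberg6_iff
    (M : Matrix (ZMod D × ZMod D × ZMod D × ZMod D × ZMod D × ZMod D)
      (ZMod D × ZMod D × ZMod D × ZMod D × ZMod D × ZMod D) ℂ) :
    M ∈ weylHeisenberg6 D ↔ ∃ x, ∃ c : ℂ, ‖c‖ = 1 ∧ M = c • weyl (tr6 D) x := by
  simp only [weylHeisenberg6, Set.mem_ofPred_eq, quditXZ_eq_weyl, weyl_kronecker_weyl]
  constructor
  · rintro ⟨_, _, _, _, _, _, _, _, _, _, _, _, c, hc, rfl⟩
    exact ⟨_, c, hc, rfl⟩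
  · rintro ⟨⟨⟨a₁, a₂, a₃, a₄, a₅, a₆⟩, b₁, b₂, b₃, b₄, b₅, b₆⟩, c, hc, rfl⟩
    exact ⟨a₁, b₁, a₂, b₂, a₃, b₃, a₄, b₄, a₅, b₅, a₆, b₆, c, hc, rfl⟩

lemma isClifford6_of_weylConj
    {U : Matrix (ZMod D × ZMod D × ZMod D × ZMod D × ZMod D × ZMod D)
      (ZMod D × ZMod D × ZMod D × ZMod D × ZMod D × ZMod D) ℂ}
    (hU : U ∈ Matrix.unitaryGroup _ ℂ) (h : ∀ x, ∃ y, WeylConj (tr6 D) U x y) :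
    IsClifford6 D U := by
  refine ⟨hU, fun w hw => ?_⟩
  rw [mem_weylHeisenberg6_iff] at hw ⊢
  obtain ⟨x, c, hc, rfl⟩ := hw
  obtain ⟨y, c', hc', hy⟩ := h x
  refine ⟨y, c * c', by simp [hc, hc'], ?_⟩
  rw [Matrix.mem_unitaryGroup_iff, star_eq_conjTranspose] at hU
  rw [mul_smul_comm, hy, smul_smul, smul_mul_assoc, mul_assoc, hU, mul_one]

/-- The relabelling that moves the last two qudits to the first and fourth places. -/
def siteShuffle (D : ℕ) : (ZMod D × ZMod D × ZMod D × ZMod D × ZMod D × ZMod D) ≃+*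
    (ZMod D × ZMod D × ZMod D × ZMod D × ZMod D × ZMod D) where
  toFun q := (q.2.2.2.2.1, q.1, q.2.1, q.2.2.2.2.2, q.2.2.1, q.2.2.2.1)
  invFun p := (p.2.1, p.2.2.1, p.2.2.2.2.1, p.2.2.2.2.2, p.1, p.2.2.2.1)
  left_inv _ := rfl
  right_inv _ := rfl
  map_mul' _ _ := rfl
  map_add' _ _ := rfl

/-- A Clifford unitary sending the Weyl operators of the last two qudits to operators acting in
the same way on the first and fourth qudits, times prescribed commuting operators on the others:
`m` gives the exponents of `X ⊗ X` and `Z ⊗ Z⁻¹` on the pairs `(2, 5)` and `(3, 6)`. -/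
lemma exists_clifford_extension (m : Fin 4 → ZMod D × ZMod D × ZMod D × ZMod D) :
    ∃ U ∈ Matrix.unitaryGroup (ZMod D × ZMod D × ZMod D × ZMod D × ZMod D × ZMod D) ℂ,
      (∀ x, ∃ y, WeylConj (tr6 D) U x y) ∧
      ∀ v w v' w' : ZMod D, WeylConj (tr6 D) U ((0, 0, 0, 0, v, v'), (0, 0, 0, 0, w, w'))
        ((v, tr4 D (m 0 * (v, w, v', w')), tr4 D (m 2 * (v, w, v', w')), v',
            tr4 D (m 0 * (v, w, v', w')), tr4 D (m 2 * (v, w, v', w'))),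
          (w, tr4 D (m 1 * (v, w, v', w')), tr4 D (m 3 * (v, w, v', w')), w',
            -tr4 D (m 1 * (v, w, v', w')), -tr4 D (m 3 * (v, w, v', w')))) := by
  set n : Fin 4 → (ZMod D × ZMod D × ZMod D × ZMod D × ZMod D × ZMod D) ×
      (ZMod D × ZMod D × ZMod D × ZMod D × ZMod D × ZMod D) := fun k =>
    (((m k).2.1, 0, 0, (m k).2.2.2, 0, 0), (-(m k).1, 0, 0, -(m k).2.2.1, 0, 0)) with hn
  obtain ⟨U, hU, hUc⟩ := exists_permutation (tr6 D) (siteShuffle D) fun x => by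
    simp only [tr6_apply, siteShuffle, RingEquiv.coe_mk, Equiv.coe_fn_mk]
    ring
  obtain ⟨C₀, hC₀, hC₀c⟩ := exists_transvection (tr6 D) (n 0) ((0, 1, 0, 0, 1, 0), 0)
    (by simp [symp, hn, tr6_apply])
  obtain ⟨C₁, hC₁, hC₁c⟩ := exists_transvection (tr6 D) (n 1) (0, (0, 1, 0, 0, -1, 0))
    (by simp [symp, hn, tr6_apply])
  obtain ⟨C₂, hC₂, hC₂c⟩ := exists_transvection (tr6 D) (n 2) ((0, 0, 1, 0, 0, 1), 0)
    (by simp [symp, hn, tr6_apply])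
  obtain ⟨C₃, hC₃, hC₃c⟩ := exists_transvection (tr6 D) (n 3) (0, (0, 0, 1, 0, 0, -1))
    (by simp [symp, hn, tr6_apply])
  refine ⟨C₃ * (C₂ * (C₁ * (C₀ * U))),
    mul_mem hC₃ (mul_mem hC₂ (mul_mem hC₁ (mul_mem hC₀ hU))), fun x =>
      ⟨_, (hC₃c _).mul ((hC₂c _).mul ((hC₁c _).mul ((hC₀c _).mul (hUc x))))⟩, fun v w v' w' => ?_⟩
  convert (hC₃c _).mul ((hC₂c _).mul ((hC₁c _).mul ((hC₀c _).mul (hUc _)))) using 1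
  simp only [Prod.ext_iff]
  simp [hn, siteShuffle, symp, tr6_apply, tr4_apply]
  refine ⟨⟨?_, ?_, ?_, ?_⟩, ?_, ?_, ?_, ?_⟩ <;> ring

end Qudits

section Symmetry

open scoped MatrixOrder in
/-- The positive square root of `Aᴴ * A` commutes with every unitary symmetry of `A`. -/
lemma commute_of_sq_eq_conjTranspose_mul_self {m n : Type*} [Fintype m] [DecidableEq m] [Fintype n]
    [DecidableEq n] {A : Matrix m n ℂ} {Q W : Matrix n n ℂ} {u : Matrix m m ℂ}
    (hQ : Q.PosSemidef) (hQA : Q * Q = Aᴴ * A) (hu : u ∈ Matrix.unitaryGroup m ℂ)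
    (hW : W ∈ Matrix.unitaryGroup n ℂ) (h : u * A = A * W) : W * Q = Q * W := by
  have hW' : W * Wᴴ = 1 := Matrix.mem_unitaryGroup_iff.mp hW
  have hu' : uᴴ * u = 1 := Matrix.mem_unitaryGroup_iff'.mp hu
  have hA : Wᴴ * (Aᴴ * A) * W = Aᴴ * A := by
    have : Wᴴ * (Aᴴ * A) * W = (A * W)ᴴ * (A * W) := by
      simp only [conjTranspose_mul, Matrix.mul_assoc]
    rw [this, ← h, conjTranspose_mul, Matrix.mul_assoc, ← Matrix.mul_assoc uᴴ, hu', Matrix.one_mul]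
  have hQ' : (Wᴴ * Q * W).PosSemidef := hQ.conjTranspose_mul_mul_same W
  have hsq : (Wᴴ * Q * W) * (Wᴴ * Q * W) = Q * Q := by
    rw [hQA, ← hA, ← hQA]
    calc _ = Wᴴ * Q * (W * Wᴴ) * Q * W := by simp only [Matrix.mul_assoc]
      _ = _ := by rw [hW', Matrix.mul_one, Matrix.mul_assoc Wᴴ]
  have := (CFC.mul_self_eq_mul_self_iff _ _ hQ'.nonneg hQ.nonneg).mp hsq
  calc W * Q = W * (Wᴴ * Q * W) := by rw [this]
    _ = (W * Wᴴ) * Q * W := by simp only [Matrix.mul_assoc]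
    _ = Q * W := by rw [hW', Matrix.one_mul]

variable {D : ℕ} [NeZero D]

lemma eq_stdAddChar_of_pow_eq_one {c : ℂ} (hc : c ^ D = 1) : ∃ k : ZMod D, c = stdAddChar k := by
  obtain ⟨i, -, rfl⟩ := (Complex.isPrimitiveRoot_exp D (NeZero.ne D)).eq_pow_of_pow_eq_one hc
  refine ⟨(i : ZMod D), ?_⟩
  rw [← Int.cast_natCast (R := ZMod D) i, ZMod.stdAddChar_coe, ← Complex.exp_nat_mul]
  congr 1
  push_cast
  ring

/-- Schur's lemma for the Weyl operators of one qudit, up to phases: a nonzero intertwiner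
is a vector tensored with a Weyl operator. -/
lemma eq_weyl_of_projective_intertwine {ι : Type*} {f : ι → ZMod D → ZMod D → ℂ} {c c' : ℂ}
    (hX : ∀ i l l', f i l l' = c * f i (l + 1) (l' + 1))
    (hZ : ∀ i l l', stdAddChar l * f i l l' = c' * (f i l l' * stdAddChar l'))
    (hf : ∃ i l l', f i l l' ≠ 0) :
    ∃ s k : ZMod D, ∀ i l l',
      f i l l' = if l = l' + s then stdAddChar (k * l') * f i s 0 else 0 := by
  obtain ⟨i₀, l₀, l₀', h₀⟩ := hf
  have hc' : c' = stdAddChar (l₀ - l₀') := by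
    rw [sub_eq_add_neg, AddChar.map_add_eq_mul, ← mul_left_inj' h₀]
    linear_combination (-(stdAddChar (-l₀') : ℂ)) * hZ i₀ l₀ l₀' -
      c' * f i₀ l₀ l₀' * (by rw [← AddChar.map_add_eq_mul]; simp :
        (stdAddChar l₀' : ℂ) * stdAddChar (-l₀') = 1)
  have hsupp (i : ι) (l l' : ZMod D) (h : f i l l' ≠ 0) : l = l' + (l₀ - l₀') := by
    refine ZMod.injective_stdAddChar (mul_right_cancel₀ h ?_)
    rw [hZ, hc', AddChar.map_add_eq_mul]
    ring
  have hpow (i : ι) (l l' : ZMod D) (k : ℕ) : f i l l' = c ^ k * f i (l + k) (l' + k) := by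
    induction k with
    | zero => simp
    | succ k ih =>
      rw [ih, hX]
      push_cast
      ring_nf
  have hc : c ^ D = 1 := by
    have := hpow i₀ l₀ l₀' D
    rw [CharP.cast_eq_zero, add_zero, add_zero] at this
    exact (mul_eq_right₀ h₀).mp this.symm
  obtain ⟨k, rfl⟩ := eq_stdAddChar_of_pow_eq_one hc
  refine ⟨l₀ - l₀', -k, fun i l l' => ?_⟩
  split_ifs with h
  · subst h
    have := hpow i (l₀ - l₀') 0 l'.val
    rw [ZMod.natCast_zmod_val, zero_add, add_comm, ← AddChar.map_nsmul_eq_pow, nsmul_eq_mul,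
      ZMod.natCast_zmod_val] at this
    rw [this, ← mul_assoc, ← AddChar.map_add_eq_mul]
    ring_nf
    simp
  · by_contra h'
    exact h (hsupp i l l' h')

/-- Schur's lemma for the Weyl operators of the last two of six qudits, up to phases. -/
lemma eq_weyl_mul_of_projective_intertwine
    {M : Matrix (ZMod D × ZMod D × ZMod D × ZMod D × ZMod D × ZMod D) (ZMod D × ZMod D) ℂ}
    (hM : M ≠ 0)
    (h : ∀ γ ∈ [((1, 0), (0, 0)), ((0, 0), (1, 0)), ((0, 1), (0, 0)), ((0, 0), (0, 1))],
      ∃ c : ℂ, weyl (tr6 D) ((0, 0, 0, 0, γ.1.1, γ.1.2), (0, 0, 0, 0, γ.2.1, γ.2.2)) * M =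
        c • (M * weyl (tr2 D) γ)) :
    ∃ s s' k k' : ZMod D, ∀ q₁ q₂ q₃ q₄ l b l' b', M (q₁, q₂, q₃, q₄, l, b) (l', b') =
      if l = l' + s ∧ b = b' + s' then
        stdAddChar (k * l' + k' * b') * M (q₁, q₂, q₃, q₄, s, s') (0, 0) else 0 := by
  simp only [List.mem_cons, List.not_mem_nil, or_false, forall_eq_or_imp, forall_eq] at h
  obtain ⟨⟨c₁, h₁⟩, ⟨c₂, h₂⟩, ⟨c₃, h₃⟩, ⟨c₄, h₄⟩⟩ := h
  have h₁ := fun (q : ZMod D × ZMod D × ZMod D × ZMod D) l b l' b' =>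
    congrFun₂ h₁ (q.1, q.2.1, q.2.2.1, q.2.2.2, l + 1, b) (l', b')
  have h₂ := fun (q : ZMod D × ZMod D × ZMod D × ZMod D) l b l' b' =>
    congrFun₂ h₂ (q.1, q.2.1, q.2.2.1, q.2.2.2, l, b) (l', b')
  have h₃ := fun (q : ZMod D × ZMod D × ZMod D × ZMod D) l b l' b' =>
    congrFun₂ h₃ (q.1, q.2.1, q.2.2.1, q.2.2.2, l, b + 1) (l', b')
  have h₄ := fun (q : ZMod D × ZMod D × ZMod D × ZMod D) l b l' b' =>
    congrFun₂ h₄ (q.1, q.2.1, q.2.2.1, q.2.2.2, l, b) (l', b')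
  simp only [weyl_mul_apply, mul_weyl_apply, Matrix.smul_apply, smul_eq_mul, tr6_apply, tr2_apply,
    Prod.mk_sub_mk, Prod.mk_add_mk, Prod.mk_mul_mk, zero_mul, one_mul, add_zero, zero_add,
    sub_zero, add_sub_cancel_right, AddChar.map_zero_eq_one, mul_one] at h₁ h₂ h₃ h₄
  have hM' : ∃ q : ZMod D × ZMod D × ZMod D × ZMod D, ∃ l b l' b',
      M (q.1, q.2.1, q.2.2.1, q.2.2.2, l, b) (l', b') ≠ 0 := by
    by_contra! h'
    refine hM (Matrix.ext fun i j => ?_)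
    exact h' (i.1, i.2.1, i.2.2.1, i.2.2.2.1) i.2.2.2.2.1 i.2.2.2.2.2 j.1 j.2
  obtain ⟨q, l, b, l', b', h₀⟩ := hM'
  obtain ⟨s, k, hs⟩ := eq_weyl_of_projective_intertwine
    (f := fun (i : (ZMod D × ZMod D × ZMod D × ZMod D) × ZMod D × ZMod D) l l' =>
      M (i.1.1, i.1.2.1, i.1.2.2.1, i.1.2.2.2, l, i.2.1) (l', i.2.2)) (c := c₁) (c' := c₂)
    (fun i l l' => h₁ i.1 l i.2.1 l' i.2.2) (fun i l l' => h₂ i.1 l i.2.1 l' i.2.2)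
    ⟨(q, b, b'), l, l', h₀⟩
  obtain ⟨s', k', hs'⟩ := eq_weyl_of_projective_intertwine
    (f := fun (i : (ZMod D × ZMod D × ZMod D × ZMod D) × ZMod D × ZMod D) b b' =>
      M (i.1.1, i.1.2.1, i.1.2.2.1, i.1.2.2.2, i.2.1, b) (i.2.2, b')) (c := c₃) (c' := c₄)
    (fun i b b' => h₃ i.1 i.2.1 b i.2.2 b') (fun i b b' => h₄ i.1 i.2.1 b i.2.2 b')
    ⟨(q, l, l'), b, b', h₀⟩
  refine ⟨s, s', k, k', fun q₁ q₂ q₃ q₄ l b l' b' => ?_⟩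
  have e := hs ((q₁, q₂, q₃, q₄), b, b') l l'
  have e' := hs' ((q₁, q₂, q₃, q₄), s, 0) b b'
  simp only at e e'
  rw [e, e', AddChar.map_add_eq_mul]
  simp only [← ite_and, mul_ite, mul_zero, mul_assoc]

end Symmetry

section Reshuffle

variable {D : ℕ} [NeZero D]

/-- The reshuffle of a four-qudit operator into a map from the outer virtual legs (first and fourth)
to the output qudits and the two middle virtual legs. -/
def sideways (Q : Matrix (ZMod D × ZMod D × ZMod D × ZMod D)
    (ZMod D × ZMod D × ZMod D × ZMod D) ℂ) :
    Matrix (ZMod D × ZMod D × ZMod D × ZMod D × ZMod D × ZMod D) (ZMod D × ZMod D) ℂ :=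
  Matrix.of fun i j => Q (i.1, i.2.1, i.2.2.1, i.2.2.2.1) (j.1, i.2.2.2.2.1, i.2.2.2.2.2, j.2)

lemma weyl_mul_sideways {Q : Matrix (ZMod D × ZMod D × ZMod D × ZMod D)
    (ZMod D × ZMod D × ZMod D × ZMod D) ℂ} {v w v' w' a₁ b₁ a₂ b₂ : ZMod D}
    (h : weyl (tr4 D) ((v, a₁, a₂, v'), (w, b₁, b₂, w')) * Q =
      Q * weyl (tr4 D) ((v, a₁, a₂, v'), (w, b₁, b₂, w'))) :
    weyl (tr6 D) ((v, a₁, a₂, v', a₁, a₂), (w, b₁, b₂, w', -b₁, -b₂)) * sideways Q =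
      sideways Q * weyl (tr2 D) ((v, v'), (w, w')) := by
  ext ⟨p₁, p₂, p₃, p₄, t, r⟩ ⟨l, b⟩
  have := apply_add_of_commute_weyl (tr4 D) h (p₁ - v, p₂ - a₁, p₃ - a₂, p₄ - v')
    (l, t - a₁, r - a₂, b)
  simp only [Prod.mk_add_mk, sub_add_cancel] at this
  rw [weyl_mul_apply, mul_weyl_apply]
  simp only [sideways, Matrix.of_apply, Prod.mk_sub_mk, Prod.mk_add_mk]
  rw [this, mul_right_comm, ← AddChar.map_add_eq_mul]
  congr 2
  simp only [tr6_apply, tr4_apply, tr2_apply, Prod.mk_sub_mk, Prod.mk_mul_mk]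
  ring

lemma commute_weyl_of_symmetry {d : ℕ}
    {A : Matrix (Fin d) (ZMod D × ZMod D × ZMod D × ZMod D) ℂ}
    {Q : Matrix (ZMod D × ZMod D × ZMod D × ZMod D) (ZMod D × ZMod D × ZMod D × ZMod D) ℂ}
    (hQ : Q.PosSemidef) (hQA : Q * Q = Aᴴ * A) {u : Matrix (Fin d) (Fin d) ℂ}
    (hu : u ∈ Matrix.unitaryGroup (Fin d) ℂ) {W₁ W₂ : Matrix (ZMod D) (ZMod D) ℂ}
    (hW₁ : W₁ ∈ weylHeisenberg1 D) (hW₂ : W₂ ∈ weylHeisenberg1 D) {v w v' w' : ZMod D}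
    (h : u * A = A * (quditXZ D v w ⊗ₖ (W₁ ⊗ₖ (W₂ ⊗ₖ quditXZ D v' w')))) :
    ∃ a₁ b₁ a₂ b₂ : ZMod D, weyl (tr4 D) ((v, a₁, a₂, v'), (w, b₁, b₂, w')) * Q =
      Q * weyl (tr4 D) ((v, a₁, a₂, v'), (w, b₁, b₂, w')) := by
  obtain ⟨a₁, b₁, c₁, hc₁, rfl⟩ := hW₁
  obtain ⟨a₂, b₂, c₂, hc₂, rfl⟩ := hW₂
  refine ⟨a₁, b₁, a₂, b₂, ?_⟩
  have hc : ‖c₁ * c₂‖ = 1 := by simp [hc₁, hc₂]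
  have hc0 : c₁ * c₂ ≠ 0 := norm_ne_zero_iff.mp (by rw [hc]; exact one_ne_zero)
  have hW : quditXZ D v w ⊗ₖ ((c₁ • quditXZ D a₁ b₁) ⊗ₖ ((c₂ • quditXZ D a₂ b₂) ⊗ₖ
      quditXZ D v' w')) =
      (c₁ * c₂) • weyl (tr4 D) ((v, a₁, a₂, v'), (w, b₁, b₂, w')) := by
    simp only [Matrix.smul_kronecker, Matrix.kronecker_smul, quditXZ_eq_weyl, weyl_kronecker_weyl,
      smul_smul, mul_comm c₂]
    rfl
  rw [hW] at h
  have hmem : (c₁ * c₂) • weyl (tr4 D) ((v, a₁, a₂, v'), (w, b₁, b₂, w')) ∈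
      Matrix.unitaryGroup (ZMod D × ZMod D × ZMod D × ZMod D) ℂ := by
    rw [Matrix.mem_unitaryGroup_iff', star_eq_conjTranspose, conjTranspose_smul,
      smul_mul_smul_comm, weyl_conjTranspose_mul_self, Complex.star_def,
      ← Complex.normSq_eq_conj_mul_self, Complex.normSq_eq_norm_sq, hc]
    simp
  have := commute_of_sq_eq_conjTranspose_mul_self hQ hQA hu hmem h
  rw [smul_mul_assoc, mul_smul_comm] at this
  exact smul_right_injective _ hc0 this

lemma quditXZ_zero : quditXZ D 0 0 = 1 := by
  rw [quditXZ_eq_weyl]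
  exact weyl_zero _

lemma map_conj_quditXZ (v w : ZMod D) :
    (quditXZ D v w).map (starRingEnd ℂ) = quditXZ D v (-w) := by
  rw [quditXZ_eq_weyl, map_conj_weyl, quditXZ_eq_weyl]

/-- Composing an intertwiner `V` of Weyl operators with the adjoint of a unitary that implements
`WeylConj` yields an intertwiner up to a phase. -/
lemma WeylConj.exists_conjTranspose_mul {R S : Type*} [CommRing R] [Algebra (ZMod D) R]
    [DecidableEq R] [Fintype R] [CommRing S] [Algebra (ZMod D) S] [DecidableEq S] [Fintype S]
    {tr : R →ₗ[ZMod D] ZMod D} {tr' : S →ₗ[ZMod D] ZMod D} {U : Matrix R R ℂ} {x y : R × R}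
    {γ : S × S} {V : Matrix R S ℂ} (hU : U ∈ Matrix.unitaryGroup R ℂ) (h : WeylConj tr U x y)
    (hV : weyl tr y * V = V * weyl tr' γ) :
    ∃ c : ℂ, weyl tr x * (Uᴴ * V) = c • (Uᴴ * V * weyl tr' γ) := by
  obtain ⟨c, -, h⟩ := h
  have hU₁ : U * Uᴴ = 1 := Matrix.mem_unitaryGroup_iff.mp hU
  have hU₂ : Uᴴ * U = 1 := Matrix.mem_unitaryGroup_iff'.mp hU
  refine ⟨c, ?_⟩
  calc weyl tr x * (Uᴴ * V) = Uᴴ * (U * weyl tr x) * (Uᴴ * V) := by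
        rw [← Matrix.mul_assoc Uᴴ, hU₂, Matrix.one_mul]
    _ = c • (Uᴴ * (weyl tr y * ((U * Uᴴ) * V))) := by
        rw [h]
        simp only [Matrix.mul_smul, Matrix.smul_mul, Matrix.mul_assoc]
    _ = c • (Uᴴ * V * weyl tr' γ) := by rw [hU₁, Matrix.one_mul, hV, Matrix.mul_assoc]

/-- A nonzero vector can be rescaled to a unit vector. -/
lemma exists_unit_rescale {ι : Type*} [Fintype ι] {ψ : ι → ℂ} (hψ : ψ ≠ 0) :
    ∃ c : ℝ, 0 ≤ c ∧ ∃ φ : ι → ℂ, ∑ q, ‖φ q‖ ^ 2 = 1 ∧ ∀ q, ψ q = c * φ q := by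
  have hpos : 0 < ∑ q, ‖ψ q‖ ^ 2 := by
    obtain ⟨q, hq⟩ := Function.ne_iff.mp hψ
    exact Finset.sum_pos' (fun _ _ => by positivity)
      ⟨q, Finset.mem_univ q, by have := norm_pos_iff.mpr hq; positivity⟩
  set N := Real.sqrt (∑ q, ‖ψ q‖ ^ 2) with hN
  have hN0 : 0 < N := Real.sqrt_pos.mpr hpos
  have hN1 : (N : ℂ) ≠ 0 := by exact_mod_cast hN0.ne'
  refine ⟨N, hN0.le, fun q => (N : ℂ)⁻¹ * ψ q, ?_, fun q => by field_simp⟩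
  simp_rw [norm_mul, mul_pow, ← Finset.mul_sum]
  rw [← Real.sq_sqrt hpos.le, ← hN, norm_inv, Complex.norm_real, Real.norm_of_nonneg hN0.le]
  field_simp

end Reshuffle

/-- **Clifford structure of MF PEPS.**
Let `A` be a PEPS tensor (virtual indices ordered left, top, right, bottom)
with the Weyl–Heisenberg PEPS MF symmetry and `Q` the positive semidefinite
square root of `Aᴴ * A`.  Then the sideways reshuffle
`V_Q (p₁,p₂,p₃,p₄,t,r) (l,b) := Q (p₁,p₂,p₃,p₄) (l,t,r,b)` is proportional to a
6-qudit Clifford unitary applied to a fixed unit state `ψ` on 4 qudits tensored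
with the identity on the virtual input. -/
theorem mf_peps_clifford_structure (D d : ℕ) [NeZero D] (hd : 1 ≤ d)
    (A : Matrix (Fin d) (ZMod D × ZMod D × ZMod D × ZMod D) ℂ)
    (hsymA : ∀ v w : ZMod D, ∃ u ∈ Matrix.unitaryGroup (Fin d) ℂ,
      ∃ W₁ ∈ weylHeisenberg1 D, ∃ W₂ ∈ weylHeisenberg1 D,
        u * A = A * ((quditXZ D v w).map (starRingEnd ℂ) ⊗ₖ
          (W₁ ⊗ₖ (W₂ ⊗ₖ (1 : Matrix (ZMod D) (ZMod D) ℂ)))))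
    (hsymB : ∀ v w : ZMod D, ∃ u ∈ Matrix.unitaryGroup (Fin d) ℂ,
      ∃ W₁ ∈ weylHeisenberg1 D, ∃ W₂ ∈ weylHeisenberg1 D,
        u * A = A * ((1 : Matrix (ZMod D) (ZMod D) ℂ) ⊗ₖ
          (W₁ ⊗ₖ (W₂ ⊗ₖ (quditXZ D v w).map (starRingEnd ℂ)))))
    (Q : Matrix (ZMod D × ZMod D × ZMod D × ZMod D)
      (ZMod D × ZMod D × ZMod D × ZMod D) ℂ)
    (hQpsd : Q.PosSemidef) (hQsq : Q * Q = Aᴴ * A) :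
    ∃ c : ℝ, 0 ≤ c ∧ ∃ U, IsClifford6 D U ∧
      ∃ ψ : ZMod D × ZMod D × ZMod D × ZMod D → ℂ,
        (∑ q, ‖ψ q‖ ^ 2 = 1) ∧
        ∀ p₁ p₂ p₃ p₄ t r l b : ZMod D,
          Q (p₁, p₂, p₃, p₄) (l, t, r, b)
            = (c : ℂ) * ∑ q₁ : ZMod D, ∑ q₂ : ZMod D, ∑ q₃ : ZMod D, ∑ q₄ : ZMod D,
                U (p₁, p₂, p₃, p₄, t, r) (q₁, q₂, q₃, q₄, l, b)
                  * ψ (q₁, q₂, q₃, q₄) := by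
  by_cases hQ0 : Q = 0
  · refine ⟨0, le_rfl, 1, isClifford6_of_weylConj (one_mem _)
      fun x => ⟨x, 1, by simp, by simp⟩, Pi.single 0 1, ?_, by simp [hQ0]⟩
    rw [Finset.sum_eq_single 0] <;> simp +contextual
  have hA (v w : ZMod D) : ∃ a₁ b₁ a₂ b₂ : ZMod D,
      weyl (tr4 D) ((v, a₁, a₂, 0), (w, b₁, b₂, 0)) * Q =
        Q * weyl (tr4 D) ((v, a₁, a₂, 0), (w, b₁, b₂, 0)) := by
    obtain ⟨u, hu, W₁, hW₁, W₂, hW₂, h⟩ := hsymA v (-w)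
    rw [map_conj_quditXZ, neg_neg, ← quditXZ_zero] at h
    exact commute_weyl_of_symmetry hQpsd hQsq hu hW₁ hW₂ h
  have hB (v w : ZMod D) : ∃ a₁ b₁ a₂ b₂ : ZMod D,
      weyl (tr4 D) ((0, a₁, a₂, v), (0, b₁, b₂, w)) * Q =
        Q * weyl (tr4 D) ((0, a₁, a₂, v), (0, b₁, b₂, w)) := by
    obtain ⟨u, hu, W₁, hW₁, W₂, hW₂, h⟩ := hsymB v (-w)
    rw [map_conj_quditXZ, neg_neg, ← quditXZ_zero] at h
    exact commute_weyl_of_symmetry hQpsd hQsq hu hW₁ hW₂ h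
  obtain ⟨a₁, b₁, a₂, b₂, h₁⟩ := hA 1 0
  obtain ⟨a₁', b₁', a₂', b₂', h₂⟩ := hA 0 1
  obtain ⟨a₃, b₃, a₄, b₄, h₃⟩ := hB 1 0
  obtain ⟨a₃', b₃', a₄', b₄', h₄⟩ := hB 0 1
  obtain ⟨U, hU, hUc, hUm⟩ := exists_clifford_extension
    ![(a₁, a₁', a₃, a₃'), (b₁, b₁', b₃, b₃'), (a₂, a₂', a₄, a₄'), (b₂, b₂', b₄, b₄')]
  have hUU : U * Uᴴ = 1 := Matrix.mem_unitaryGroup_iff.mp hU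
  have hM : Uᴴ * sideways Q ≠ 0 := by
    intro h
    have hV : sideways Q = 0 := by
      rw [← Matrix.one_mul (sideways Q), ← hUU, Matrix.mul_assoc, h, Matrix.mul_zero]
    refine hQ0 (Matrix.ext fun p j => ?_)
    exact congrFun₂ hV (p.1, p.2.1, p.2.2.1, p.2.2.2, j.2.1, j.2.2.1) (j.1, j.2.2.2)
  obtain ⟨s, s', k, k', hs⟩ := eq_weyl_mul_of_projective_intertwine hM (by
    simp only [List.mem_cons, List.not_mem_nil, or_false, forall_eq_or_imp, forall_eq]
    refine ⟨(hUm 1 0 0 0).exists_conjTranspose_mul hU ?_,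
      (hUm 0 1 0 0).exists_conjTranspose_mul hU ?_,
      (hUm 0 0 1 0).exists_conjTranspose_mul hU ?_,
      (hUm 0 0 0 1).exists_conjTranspose_mul hU ?_⟩
    · simpa [tr4_apply] using weyl_mul_sideways h₁
    · simpa [tr4_apply] using weyl_mul_sideways h₂
    · simpa [tr4_apply] using weyl_mul_sideways h₃
    · simpa [tr4_apply] using weyl_mul_sideways h₄)
  set M := Uᴴ * sideways Q with hMdef
  have hψ : (fun q : ZMod D × ZMod D × ZMod D × ZMod D =>
      M (q.1, q.2.1, q.2.2.1, q.2.2.2, s, s') (0, 0)) ≠ 0 := by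
    intro h
    refine hM (Matrix.ext fun i j => ?_)
    have h0 := congrFun h (i.1, i.2.1, i.2.2.1, i.2.2.2.1)
    have h1 := hs i.1 i.2.1 i.2.2.1 i.2.2.2.1 i.2.2.2.2.1 i.2.2.2.2.2 j.1 j.2
    simp only [Pi.zero_apply] at h0
    rw [h0, mul_zero, ite_self] at h1
    exact h1
  obtain ⟨c, hc, ψ, hψ1, hcψ⟩ := exists_unit_rescale hψ
  refine ⟨c, hc, U * weyl (tr6 D) ((0, 0, 0, 0, s, s'), (0, 0, 0, 0, k, k')),
    isClifford6_of_weylConj (mul_mem hU (weyl_mem_unitaryGroup _ _)) fun x => ?_, ψ, hψ1,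
    fun p₁ p₂ p₃ p₄ t r l b => ?_⟩
  · obtain ⟨y, hy⟩ := hUc x
    exact ⟨y, hy.mul (weylConj_weyl _ _ _)⟩
  · have hV : sideways Q = U * M := by rw [hMdef, ← Matrix.mul_assoc, hUU, Matrix.one_mul]
    have hVe := congrFun₂ hV (p₁, p₂, p₃, p₄, t, r) (l, b)
    simp only [sideways, Matrix.of_apply] at hVe
    rw [hVe, Matrix.mul_apply]
    simp only [Fintype.sum_prod_type, mul_weyl_apply, Finset.mul_sum]
    refine Finset.sum_congr rfl fun q₁ _ => Finset.sum_congr rfl fun q₂ _ =>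
      Finset.sum_congr rfl fun q₃ _ => Finset.sum_congr rfl fun q₄ _ => ?_
    have hq := hcψ (q₁, q₂, q₃, q₄)
    simp only at hq
    simp only [hs _ _ _ _ _ _ l b, ite_and, mul_ite, mul_zero, hq,
      tr6_apply, Prod.mk_mul_mk, Prod.mk_add_mk, zero_mul, zero_add, add_zero]
    simp
    ring
end

section
/- Let G be a finite abelian additive group and α : G → ℂ, and define e : G → ℂ by e g := Σ_{h∈G} (α h) * conj(α (h − g)). Then: (1) for every g ∈ G, |e g| ≤ Σ_{h∈G} |α h|²; (2) if H is a subgroup of G and φ : H → ℝ satisfies α g = exp(i φ(m)) * α (g + m) for all g ∈ G and m ∈ H, then for every m ∈ H, e m = exp(−i φ(m)) * Σ_{h∈G} |α h|², and in particular |e m| = Σ_{h∈G} |α h|². Consequently, the maximum of g ↦ |e g| over G equals Σ_h |α h|² and is attained at every element of H, so it is attained at least (card H) times. -/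
open Complex

/-- The autocorrelation of a complex function on a finite abelian group is bounded by its
value at zero. -/
theorem norm_sum_mul_conj_sub_le {G : Type*} [AddCommGroup G] [Fintype G] (α : G → ℂ) (g : G) :
    ‖∑ h, α h * (starRingEnd ℂ) (α (h - g))‖ ≤ ∑ h, ‖α h‖ ^ 2 := by
  have shift : ∑ h, ‖α (h - g)‖ ^ 2 = ∑ h, ‖α h‖ ^ 2 :=
    (Equiv.subRight g).sum_comp fun h => ‖α h‖ ^ 2
  calc ‖∑ h, α h * (starRingEnd ℂ) (α (h - g))‖
      ≤ ∑ h, ‖α h * (starRingEnd ℂ) (α (h - g))‖ := norm_sum_le _ _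
    _ ≤ ∑ h, (‖α h‖ ^ 2 + ‖α (h - g)‖ ^ 2) / 2 := by
        refine Finset.sum_le_sum fun h _ => ?_
        rw [norm_mul, RCLike.norm_conj]
        linarith [two_mul_le_add_sq ‖α h‖ ‖α (h - g)‖]
    _ = ∑ h, ‖α h‖ ^ 2 := by
        rw [← Finset.sum_div, Finset.sum_add_distrib, shift, add_self_div_two]

/-- If translation by `m` multiplies `α` by a phase, then the autocorrelation of `α` at `m` is
that phase times its value at zero. -/
theorem sum_mul_conj_sub_eq_of_phase {G : Type*} [AddCommGroup G] [Fintype G] (α : G → ℂ)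
    (m : G) (t : ℝ) (hα : ∀ g, α g = Complex.exp (t * Complex.I) * α (g + m)) :
    ∑ h, α h * (starRingEnd ℂ) (α (h - m))
      = Complex.exp (-(t * Complex.I)) * ((∑ h, ‖α h‖ ^ 2 : ℝ) : ℂ) := by
  push_cast
  rw [Finset.mul_sum]
  refine Finset.sum_congr rfl fun h _ => ?_
  rw [hα (h - m), sub_add_cancel, map_mul, ← Complex.exp_conj, map_mul, Complex.conj_ofReal,
    Complex.conj_I, mul_neg, mul_left_comm, Complex.mul_conj']

/-- **Degeneracy of the largest transfer-matrix eigenvalue.**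
For a finite abelian group `G` and `α : G → ℂ`, let
`e g := Σ_h α h * conj (α (h − g))`.  Then `|e g| ≤ Σ_h |α h|²` for every `g`;
and if `H ≤ G` and `φ : H → ℝ` satisfy `α g = exp(i φ m) * α (g + m)` for all
`g : G`, `m : H`, then `e m = exp(−i φ m) * Σ_h |α h|²` (so `|e m| = Σ_h |α h|²`)
for every `m ∈ H`; consequently the maximum of `|e ·|` is attained at least
`card H` many times. -/
theorem transfer_eigenvalue_degeneracy (G : Type*) [AddCommGroup G] [Fintype G]
    (α : G → ℂ) :
    (∀ g : G, ‖∑ h, α h * (starRingEnd ℂ) (α (h - g))‖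
        ≤ ∑ h, ‖α h‖ ^ 2) ∧
    ∀ (H : AddSubgroup G) (φ : H → ℝ),
      (∀ (g : G) (m : H), α g = Complex.exp (φ m * Complex.I) * α (g + m)) →
      ((∀ m : H, (∑ h, α h * (starRingEnd ℂ) (α (h - (m : G))))
            = Complex.exp (-(φ m * Complex.I)) *
                ((∑ h, ‖α h‖ ^ 2 : ℝ) : ℂ)) ∧
        (∀ m : H, ‖∑ h, α h * (starRingEnd ℂ) (α (h - (m : G)))‖
            = ∑ h, ‖α h‖ ^ 2) ∧
        Nat.card H ≤ Set.ncard {g : G |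
          ‖∑ h, α h * (starRingEnd ℂ) (α (h - g))‖
            = ∑ h, ‖α h‖ ^ 2}) := by
  refine ⟨norm_sum_mul_conj_sub_le α, fun H φ hα => ?_⟩
  have eigen (m : H) := sum_mul_conj_sub_eq_of_phase α m (φ m) fun g => hα g m
  have norm_eigen (m : H) : ‖∑ h, α h * (starRingEnd ℂ) (α (h - (m : G)))‖
      = ∑ h, ‖α h‖ ^ 2 := by
    rw [eigen m, norm_mul, ← neg_mul, ← Complex.ofReal_neg, Complex.norm_exp_ofReal_mul_I,
      one_mul, Complex.norm_of_nonneg (Finset.sum_nonneg fun _ _ => sq_nonneg _)]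
  refine ⟨eigen, norm_eigen, ?_⟩
  rw [← SetLike.coe_sort_coe, Nat.card_coe_set_eq]
  exact Set.ncard_le_ncard (fun g hg => norm_eigen ⟨g, hg⟩) (Set.toFinite _)
end

section
/- Let d, D ≥ 1, let A : Matrix (Fin d) (Fin D × Fin D × Fin D × Fin D) ℂ, let M be a unitary D×D complex matrix and φ ∈ ℝ, and assume A = exp(iφ) • (A * (M ⊗ₖ M ⊗ₖ conj(M) ⊗ₖ conj(M))). If A is injective as a linear map from ℂ^{D⁴} to ℂ^d (equivalently, the columns of A are linearly independent), then there exists λ ∈ ℂ with |λ| = 1 such that M = λ • 1, and exp(iφ) = 1. In particular, an injective PEPS tensor cannot carry such a symmetry with M not proportional to the identity, so PEPS with a nontrivial symmetry of this type are necessarily non-injective. -/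
open Matrix Kronecker

/-- A matrix with injective `mulVec` can be cancelled on the left. -/
theorem Matrix.mul_left_cancel_of_mulVecLin_injective {m n p R : Type*} [Fintype n] [Fintype p]
    [CommSemiring R] {A : Matrix m n R} (hA : Function.Injective A.mulVecLin)
    {B C : Matrix n p R} (h : A * B = A * C) : B = C := by
  classical
  refine Matrix.ext_of_mulVec_single fun i => hA ?_
  simp only [Matrix.mulVecLin_apply, Matrix.mulVec_mulVec, h]

/-- **Injective PEPS cannot carry a nontrivial topological-type symmetry.**
If a PEPS tensor `A` satisfies `A = exp(iφ) • (A * (M ⊗ₖ M ⊗ₖ conj M ⊗ₖ conj M))`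
for some unitary `M` and `A` is injective as a linear map from the virtual
space `ℂ^{D⁴}` to the physical space `ℂ^d`, then `M` is proportional to the
identity by a unimodular scalar and `exp(iφ) = 1`. -/
theorem injective_peps_trivial_symmetry (d D : ℕ) (hd : 1 ≤ d) (hD : 1 ≤ D)
    (A : Matrix (Fin d) (Fin D × Fin D × Fin D × Fin D) ℂ)
    (M : Matrix (Fin D) (Fin D) ℂ)
    (hM : M ∈ Matrix.unitaryGroup (Fin D) ℂ)
    (φ : ℝ)
    (hsym : A = Complex.exp (φ * Complex.I) •
      (A * (M ⊗ₖ (M ⊗ₖ (M.map (starRingEnd ℂ) ⊗ₖ M.map (starRingEnd ℂ))))))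
    (hinj : Function.Injective A.mulVecLin) :
    (∃ lam : ℂ, ‖lam‖ = 1 ∧ M = lam • (1 : Matrix (Fin D) (Fin D) ℂ)) ∧
      Complex.exp (φ * Complex.I) = 1 := by
  set c := Complex.exp (φ * Complex.I) with hc
  have hc1 : ‖c‖ = 1 := Complex.norm_exp_ofReal_mul_I φ
  have hK : (1 : Matrix (Fin D × Fin D × Fin D × Fin D) _ ℂ) =
      c • (M ⊗ₖ (M ⊗ₖ (M.map (starRingEnd ℂ) ⊗ₖ M.map (starRingEnd ℂ)))) := by
    refine Matrix.mul_left_cancel_of_mulVecLin_injective hinj ?_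
    rw [Matrix.mul_one, Matrix.mul_smul]
    exact hsym
  let o : Fin D := ⟨0, hD⟩
  have hentry (i j : Fin D) : (1 : Matrix (Fin D) (Fin D) ℂ) i j =
      c * (M i j * (M o o * (starRingEnd ℂ (M o o) * starRingEnd ℂ (M o o)))) := by
    have h := congrFun₂ hK (i, o, o, o) (j, o, o, o)
    simpa [Matrix.one_apply] using h
  have hoo : 1 = c * (M o o * (M o o * (starRingEnd ℂ (M o o) * starRingEnd ℂ (M o o)))) := by
    simpa using hentry o o
  have hnorm : ‖M o o‖ = 1 := by
    have h : (1 : ℝ) = ‖M o o‖ ^ 4 := by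
      have h := congrArg norm hoo
      simp only [norm_mul, norm_one, RCLike.norm_conj, hc1] at h
      linarith
    exact (pow_eq_one_iff_of_nonneg (norm_nonneg _) (by norm_num)).mp h.symm
  have hconj : M o o * starRingEnd ℂ (M o o) = 1 := by
    rw [Complex.mul_conj', hnorm]
    norm_num
  have hc_one : c = 1 := by
    linear_combination -hoo - c * (M o o * starRingEnd ℂ (M o o) + 1) * hconj
  refine ⟨⟨M o o, hnorm, ?_⟩, hc_one⟩
  ext i j
  have h := hentry i j
  rw [hc_one] at h
  rw [Matrix.smul_apply, smul_eq_mul]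
  linear_combination -M o o * h - M i j * (M o o * starRingEnd ℂ (M o o) + 1) * hconj
end
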